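/- arXiv:2410.11724 — 3 statements merged into one kernel-verified Lean document; each statement's English description precedes it below -/
import Mathlib

section
/- Let d ≥ 1, 1 ≤ α < 2, and let f : ℝ^d → ℝ be locally square-integrable. Fix a smooth nonnegative φ : ℝ^d → ℝ supported in the unit ball with ∫ φ = 1, and set φ_r(x) := r^{−d} φ(x/r). Suppose there is C₁ < ∞ such that for every z ∈ ℝ^d and R > 0, ∫_0^R ∫_{B_R(z)} ( ν₁^f(x,r) / r^{α−1} )² dx dr/r ≤ C₁ R^d. Then there is a constant C depending only on d, α and φ such that for every z ∈ ℝ^d and R > 0, ∫_0^R ∫_{B_R(z)} ( ν̃₁^f(x,r) / r^{α−1} )² dx dr/r ≤ C C₁ R^d. -/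
open MeasureTheory Metric RealInnerProductSpace

/-- `ν₁^f(x,r)`: the best `L²`-approximation of `f` by affine functions on `B_r(x)`,
normalized by `r`. -/
noncomputable def nu1 (d : ℕ) (f : EuclideanSpace ℝ (Fin d) → ℝ)
    (x : EuclideanSpace ℝ (Fin d)) (r : ℝ) : ℝ :=
  ⨅ p : EuclideanSpace ℝ (Fin d) × ℝ,
    Real.sqrt (⨍ y in ball x r, ((f y - (⟪p.1, y⟫ + p.2)) / r) ^ 2)

/-- The gradient of the mollification `φ_r ∗ f` at `x`, where `φ_r(x) = r^{−d} φ(x/r)`. -/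
noncomputable def mollifiedGrad (d : ℕ) (φ f : EuclideanSpace ℝ (Fin d) → ℝ) (r : ℝ)
    (x : EuclideanSpace ℝ (Fin d)) : EuclideanSpace ℝ (Fin d) :=
  gradient (fun w => ∫ y, (r ^ (-(d : ℝ)) * φ (r⁻¹ • (w - y))) * f y) x

/-- `ν̃₁^f(x,r)`: the normalized `L²` mean of `f(x+y) − f(x) − ∇(φ_r ∗ f)(x)·y` over the
annulus `r/2 ≤ |y| ≤ r`. -/
noncomputable def nu1tilde (d : ℕ) (φ f : EuclideanSpace ℝ (Fin d) → ℝ)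
    (x : EuclideanSpace ℝ (Fin d)) (r : ℝ) : ℝ :=
  Real.sqrt (⨍ y in {y : EuclideanSpace ℝ (Fin d) | r / 2 ≤ ‖y‖ ∧ ‖y‖ ≤ r},
    ((f (x + y) - f x - ⟪mollifiedGrad d φ f r x, y⟫) / r) ^ 2)

lemma locallyIntegrable_of_locallyIntegrable_sq {d : ℕ} {g : EuclideanSpace ℝ (Fin d) → ℝ}
    (hg : Measurable g) (hg2 : LocallyIntegrable (fun x => (g x) ^ 2) volume) :
    LocallyIntegrable g volume := by
  have h1 : LocallyIntegrable (fun x => 1 + (g x) ^ 2) volume :=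
    (locallyIntegrable_const (1 : ℝ)).add hg2
  refine h1.mono hg.aestronglyMeasurable (Filter.Eventually.of_forall fun x => ?_)
  rw [Real.norm_eq_abs, Real.norm_eq_abs, abs_of_nonneg (by positivity : 0 ≤ 1 + g x ^ 2)]
  nlinarith [sq_abs (g x), sq_nonneg (|g x| - 1)]

lemma locallyIntegrable_sq_sub {d : ℕ} {f ℓ : EuclideanSpace ℝ (Fin d) → ℝ}
    (hf : Measurable f) (hf2 : LocallyIntegrable (fun x => (f x) ^ 2) volume)
    (hℓ : Continuous ℓ) : LocallyIntegrable (fun x => (f x - ℓ x) ^ 2) volume := by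
  have h1 : LocallyIntegrable (fun x => ((f x) ^ 2 + (f x) ^ 2) + 2 * (ℓ x) ^ 2) volume :=
    (hf2.add hf2).add (Continuous.locallyIntegrable (by fun_prop))
  refine h1.mono ((hf.sub hℓ.measurable).pow_const 2).aestronglyMeasurable
    (Filter.Eventually.of_forall fun x => ?_)
  rw [Real.norm_eq_abs, Real.norm_eq_abs, abs_of_nonneg (by positivity), abs_of_nonneg
    (by positivity)]
  nlinarith [sq_nonneg (f x + ℓ x)]

/-- The Cauchy–Schwarz inequality on a set of finite positive measure. -/
lemma sq_setIntegral_abs_le {X : Type*} [MeasurableSpace X] {μ : Measure X} {s : Set X}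
    {g : X → ℝ} (hs : μ s ≠ ⊤) (hs0 : 0 < μ.real s) (hg : IntegrableOn g s μ)
    (hg2 : IntegrableOn (fun x => (g x) ^ 2) s μ) :
    (∫ x in s, |g x| ∂μ) ^ 2 ≤ μ.real s * ∫ x in s, (g x) ^ 2 ∂μ := by
  set I := ∫ x in s, |g x| ∂μ with hI
  set V := μ.real s with hV
  have hconst : IntegrableOn (fun _ : X => (I / V) ^ 2) s μ := integrableOn_const hs
  have hlin : IntegrableOn (fun x => 2 * (I / V) * |g x|) s μ := hg.abs.const_mul _
  have h0 : 0 ≤ ∫ x in s, ((g x) ^ 2 - 2 * (I / V) * |g x| + (I / V) ^ 2) ∂μ := by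
    refine integral_nonneg fun x => ?_
    have : (g x) ^ 2 - 2 * (I / V) * |g x| + (I / V) ^ 2 = (|g x| - I / V) ^ 2 := by
      rw [← sq_abs (g x)]; ring
    rw [this]; positivity
  rw [integral_add (show IntegrableOn (fun x => (g x) ^ 2 - 2 * (I / V) * |g x|) s μ from
    hg2.sub hlin) hconst, integral_sub hg2 hlin, integral_const_mul,
    setIntegral_const, ← hI, ← hV, smul_eq_mul] at h0
  have h1 : V * (∫ x in s, (g x) ^ 2 ∂μ) - I ^ 2
      = V * ((∫ x in s, (g x) ^ 2 ∂μ) - 2 * (I / V) * I + V * (I / V) ^ 2) := by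
    field_simp; ring
  nlinarith [mul_nonneg hs0.le h0]

section Mollifier

variable {d : ℕ} {φ : EuclideanSpace ℝ (Fin d) → ℝ}

lemma hasCompactSupport_of_eq_zero_off_ball
    (hφsupp : ∀ x ∉ ball (0 : EuclideanSpace ℝ (Fin d)) 1, φ x = 0) : HasCompactSupport φ :=
  HasCompactSupport.of_support_subset_isCompact (isCompact_closedBall 0 1) fun x hx => by
    by_contra h
    exact hx (hφsupp x fun h' => h (ball_subset_closedBall h'))

lemma exists_fderiv_rescaled_bound (hφs : ContDiff ℝ (⊤ : ℕ∞) φ) (hφc : HasCompactSupport φ) :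
    ∃ M : ℝ, ∀ r : ℝ, 0 < r → ∀ u : EuclideanSpace ℝ (Fin d),
      ‖fderiv ℝ (fun v => r ^ (-(d : ℝ)) * φ (r⁻¹ • v)) u‖ ≤ M * (r ^ d * r)⁻¹ := by
  obtain ⟨M, hM⟩ := (hφc.fderiv (𝕜 := ℝ)).exists_bound_of_continuous
    (hφs.continuous_fderiv (by simp))
  refine ⟨M, fun r hr u => ?_⟩
  have hφd : Differentiable ℝ φ := hφs.differentiable (by simp)
  have h1 : HasFDerivAt (fun v : EuclideanSpace ℝ (Fin d) => r⁻¹ • v)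
      (r⁻¹ • ContinuousLinearMap.id ℝ (EuclideanSpace ℝ (Fin d))) u :=
    (hasFDerivAt_id u).const_smul r⁻¹
  have h2 := ((hφd (r⁻¹ • u)).hasFDerivAt.comp u h1).const_mul (r ^ (-(d : ℝ)))
  have h3 : fderiv ℝ (fun v => r ^ (-(d : ℝ)) * φ (r⁻¹ • v)) u
      = (r ^ d * r)⁻¹ • fderiv ℝ φ (r⁻¹ • u) := by
    refine (HasFDerivAt.fderiv h2).trans ?_
    rw [ContinuousLinearMap.comp_smul, ContinuousLinearMap.comp_id,
      smul_smul, Real.rpow_neg hr.le, Real.rpow_natCast, mul_inv]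
  rw [h3, norm_smul, Real.norm_of_nonneg (by positivity), mul_comm]
  exact mul_le_mul_of_nonneg_right (hM _) (by positivity)

lemma rescaled_eq_zero {r : ℝ} (hr : 0 < r)
    (hφsupp : ∀ x ∉ ball (0 : EuclideanSpace ℝ (Fin d)) 1, φ x = 0)
    {v : EuclideanSpace ℝ (Fin d)} (hv : v ∉ closedBall 0 r) :
    r ^ (-(d : ℝ)) * φ (r⁻¹ • v) = 0 := by
  rw [hφsupp, mul_zero]
  rw [mem_closedBall_zero_iff, not_le] at hv
  rw [mem_ball_zero_iff, norm_smul, norm_inv, Real.norm_of_nonneg hr.le, not_lt,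
    ← div_eq_inv_mul, le_div_iff₀ hr]
  linarith

lemma hasCompactSupport_rescaled {r : ℝ} (hr : 0 < r)
    (hφsupp : ∀ x ∉ ball (0 : EuclideanSpace ℝ (Fin d)) 1, φ x = 0) :
    HasCompactSupport fun v => r ^ (-(d : ℝ)) * φ (r⁻¹ • v) :=
  HasCompactSupport.of_support_subset_isCompact (isCompact_closedBall 0 r) fun v hv => by
    by_contra h
    exact hv (rescaled_eq_zero hr hφsupp h)

lemma contDiff_rescaled (r : ℝ) (hφs : ContDiff ℝ (⊤ : ℕ∞) φ) :
    ContDiff ℝ 1 fun v : EuclideanSpace ℝ (Fin d) => r ^ (-(d : ℝ)) * φ (r⁻¹ • v) :=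
  contDiff_const.mul ((hφs.of_le (by exact_mod_cast le_top)).comp (contDiff_id.const_smul r⁻¹))

lemma integral_rescaled {r : ℝ} (hr : 0 < r) (hφint : ∫ x, φ x = 1) :
    ∫ v : EuclideanSpace ℝ (Fin d), r ^ (-(d : ℝ)) * φ (r⁻¹ • v) = 1 := by
  rw [integral_const_mul, Measure.integral_comp_inv_smul, hφint, finrank_euclideanSpace_fin,
    Real.rpow_neg hr.le, Real.rpow_natCast, abs_of_pos (by positivity), smul_eq_mul, mul_one,
    inv_mul_cancel₀ (by positivity)]

/-- The mollification is differentiable, with gradient of size at most `M r^{-d-1} ∫_{B_r} |g|`. -/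
lemma exists_hasFDerivAt_mollification {M : ℝ}
    (hM : ∀ r : ℝ, 0 < r → ∀ u : EuclideanSpace ℝ (Fin d),
      ‖fderiv ℝ (fun v => r ^ (-(d : ℝ)) * φ (r⁻¹ • v)) u‖ ≤ M * (r ^ d * r)⁻¹)
    (hφs : ContDiff ℝ (⊤ : ℕ∞) φ)
    (hφsupp : ∀ x ∉ ball (0 : EuclideanSpace ℝ (Fin d)) 1, φ x = 0)
    {g : EuclideanSpace ℝ (Fin d) → ℝ} (hg : LocallyIntegrable g volume)
    {r : ℝ} (hr : 0 < r) (x : EuclideanSpace ℝ (Fin d)) :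
    ∃ D : EuclideanSpace ℝ (Fin d) →L[ℝ] ℝ,
      HasFDerivAt (fun w => ∫ y, (r ^ (-(d : ℝ)) * φ (r⁻¹ • (w - y))) * g y) D x ∧
      ‖D‖ ≤ M * (r ^ d * r)⁻¹ * ∫ y in closedBall x r, |g y| := by
  set K : EuclideanSpace ℝ (Fin d) → ℝ := fun v => r ^ (-(d : ℝ)) * φ (r⁻¹ • v) with hK
  have h := HasCompactSupport.hasFDerivAt_convolution_right (𝕜 := ℝ) (μ := volume)
    (ContinuousLinearMap.mul ℝ ℝ) (hasCompactSupport_rescaled hr hφsupp) hg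
    (contDiff_rescaled r hφs) x
  refine ⟨convolution g (fderiv ℝ K) ((ContinuousLinearMap.mul ℝ ℝ).precompR _) volume x,
    ?_, ?_⟩
  · have hconv : (fun w => ∫ y, (r ^ (-(d : ℝ)) * φ (r⁻¹ • (w - y))) * g y)
        = convolution g K (ContinuousLinearMap.mul ℝ ℝ) volume := by
      ext w
      exact integral_congr_ae (Filter.Eventually.of_forall fun y => mul_comm _ (g y))
    rw [hconv]
    exact h
  · rw [convolution, ← integral_const_mul, ← integral_indicator measurableSet_closedBall]
    refine norm_integral_le_of_norm_le ?_ (Filter.Eventually.of_forall fun t => ?_)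
    · rw [integrable_indicator_iff measurableSet_closedBall]
      exact ((hg.integrableOn_isCompact (isCompact_closedBall x r)).abs).const_mul _
    · by_cases ht : t ∈ closedBall x r
      · rw [Set.indicator_of_mem ht]
        have h1 : ‖((ContinuousLinearMap.mul ℝ ℝ).precompR (EuclideanSpace ℝ (Fin d)) (g t))
            (fderiv ℝ K (x - t))‖ = |g t| * ‖fderiv ℝ K (x - t)‖ := by
          rw [← Real.norm_eq_abs, ← norm_smul]
          congr 1
        rw [h1, mul_comm]
        exact mul_le_mul_of_nonneg_right (hM r hr _) (abs_nonneg _)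
      · rw [Set.indicator_of_notMem ht]
        have h0 : fderiv ℝ K (x - t) = 0 := by
          have hmem : x - t ∉ closedBall (0 : EuclideanSpace ℝ (Fin d)) r := by
            rwa [mem_closedBall_zero_iff, ← dist_eq_norm, dist_comm]
          have he : K =ᶠ[nhds (x - t)] fun _ => 0 := by
            filter_upwards [isClosed_closedBall.isOpen_compl.mem_nhds hmem] with v hv
            exact rescaled_eq_zero hr hφsupp hv
          rw [he.fderiv_eq]; simp
        rw [h0]; simp

/-- Mollification of an affine function only changes the constant term. -/
lemma integral_rescaled_mul_affine (hφs : ContDiff ℝ (⊤ : ℕ∞) φ)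
    (hφsupp : ∀ x ∉ ball (0 : EuclideanSpace ℝ (Fin d)) 1, φ x = 0)
    (hφint : ∫ x, φ x = 1) {r : ℝ} (hr : 0 < r) (a : EuclideanSpace ℝ (Fin d)) (b : ℝ) :
    ∃ c : ℝ, ∀ w : EuclideanSpace ℝ (Fin d),
      ∫ y, (r ^ (-(d : ℝ)) * φ (r⁻¹ • (w - y))) * (⟪a, y⟫ + b) = ⟪a, w⟫ + c := by
  set K : EuclideanSpace ℝ (Fin d) → ℝ := fun v => r ^ (-(d : ℝ)) * φ (r⁻¹ • v) with hK
  have hKc : HasCompactSupport K := hasCompactSupport_rescaled hr hφsupp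
  have hKcont : Continuous K := (contDiff_rescaled r hφs).continuous
  refine ⟨b - ∫ u, K u * ⟪a, u⟫, fun w => ?_⟩
  have h1 : ∫ y, K (w - y) * (⟪a, y⟫ + b) = ∫ u, K u * (⟪a, w - u⟫ + b) := by
    rw [← integral_sub_left_eq_self (fun u => K u * (⟪a, w - u⟫ + b)) volume w]
    simp
  have h2 : ∀ u, K u * (⟪a, w - u⟫ + b) = K u * (⟪a, w⟫ + b) - K u * ⟪a, u⟫ := fun u => by
    rw [inner_sub_right]; ring
  have hi1 : Integrable (fun u => K u * (⟪a, w⟫ + b)) volume :=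
    (hKcont.integrable_of_hasCompactSupport hKc).mul_const _
  have hi2 : Integrable (fun u => K u * ⟪a, u⟫) volume :=
    (hKcont.mul (by fun_prop)).integrable_of_hasCompactSupport hKc.mul_right
  rw [h1]
  simp_rw [h2]
  rw [integral_sub hi1 hi2, integral_mul_const, integral_rescaled hr hφint]
  ring

/-- Splitting off an affine function from the mollified gradient, with a bound on the rest. -/
lemma norm_mollifiedGrad_sub_le {M : ℝ}
    (hM : ∀ r : ℝ, 0 < r → ∀ u : EuclideanSpace ℝ (Fin d),
      ‖fderiv ℝ (fun v => r ^ (-(d : ℝ)) * φ (r⁻¹ • v)) u‖ ≤ M * (r ^ d * r)⁻¹)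
    (hφs : ContDiff ℝ (⊤ : ℕ∞) φ)
    (hφsupp : ∀ x ∉ ball (0 : EuclideanSpace ℝ (Fin d)) 1, φ x = 0)
    (hφint : ∫ x, φ x = 1)
    {f : EuclideanSpace ℝ (Fin d) → ℝ} (hf : LocallyIntegrable f volume)
    {r : ℝ} (hr : 0 < r) (x a : EuclideanSpace ℝ (Fin d)) (b : ℝ) :
    ‖mollifiedGrad d φ f r x - a‖ ≤
      M * (r ^ d * r)⁻¹ * ∫ y in closedBall x r, |f y - (⟪a, y⟫ + b)| := by
  have hℓ : LocallyIntegrable (fun y : EuclideanSpace ℝ (Fin d) => ⟪a, y⟫ + b) volume :=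
    Continuous.locallyIntegrable (by fun_prop)
  obtain ⟨D, hD, hDb⟩ :=
    exists_hasFDerivAt_mollification hM hφs hφsupp (hf.sub hℓ) hr x
  obtain ⟨c, hc⟩ := integral_rescaled_mul_affine hφs hφsupp hφint hr a b
  have hint : ∀ {h : EuclideanSpace ℝ (Fin d) → ℝ}, LocallyIntegrable h volume → ∀ w,
      Integrable (fun y => (r ^ (-(d : ℝ)) * φ (r⁻¹ • (w - y))) * h y) volume := by
    intro h hh w
    have := HasCompactSupport.convolutionExists_right (μ := volume)
      (ContinuousLinearMap.mul ℝ ℝ) (hasCompactSupport_rescaled hr hφsupp) hh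
      (contDiff_rescaled r hφs).continuous w
    refine (show Integrable _ volume from this).congr (Filter.Eventually.of_forall fun y => ?_)
    exact mul_comm _ _
  have hfun : (fun w => ∫ y, (r ^ (-(d : ℝ)) * φ (r⁻¹ • (w - y))) * f y)
      = fun w => (∫ y, (r ^ (-(d : ℝ)) * φ (r⁻¹ • (w - y))) * (f - fun y => ⟪a, y⟫ + b) y)
        + (⟪a, w⟫ + c) := by
    ext w
    rw [← hc w, ← integral_add (hint (hf.sub hℓ) w) (hint hℓ w)]
    refine integral_congr_ae (Filter.Eventually.of_forall fun y => ?_)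
    simp only [Pi.sub_apply]; ring
  have hlin : HasFDerivAt (fun w : EuclideanSpace ℝ (Fin d) => ⟪a, w⟫ + c)
      (InnerProductSpace.toDual ℝ _ a) x :=
    ((InnerProductSpace.toDual ℝ (EuclideanSpace ℝ (Fin d)) a).hasFDerivAt).add_const c
  have hgrad : mollifiedGrad d φ f r x = (InnerProductSpace.toDual ℝ _).symm D + a := by
    rw [mollifiedGrad, gradient, hfun, (hD.fun_add hlin).fderiv, map_add,
      LinearIsometryEquiv.symm_apply_apply]
  rw [hgrad, add_sub_cancel_right, LinearIsometryEquiv.norm_map]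
  exact hDb

end Mollifier

section Volume

variable {d : ℕ}

lemma volume_real_ball_euclidean (hd : 0 < d) (x : EuclideanSpace ℝ (Fin d)) {r : ℝ}
    (hr : 0 ≤ r) :
    volume.real (ball x r) = r ^ d * volume.real (ball (0 : EuclideanSpace ℝ (Fin d)) 1) := by
  have : Nontrivial (EuclideanSpace ℝ (Fin d)) :=
    Module.nontrivial_of_finrank_pos (R := ℝ) (by rwa [finrank_euclideanSpace_fin])
  rw [← Measure.addHaar_real_closedBall_eq_addHaar_real_ball, Measure.addHaar_real_closedBall _ _ hr,
    finrank_euclideanSpace_fin]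

lemma volume_real_unitBall_pos :
    0 < volume.real (ball (0 : EuclideanSpace ℝ (Fin d)) 1) :=
  ENNReal.toReal_pos (measure_ball_pos _ _ one_pos).ne' measure_ball_lt_top.ne

lemma volume_real_annulus_ge (hd : 0 < d) {r : ℝ} (hr : 0 < r) :
    (r / 4) ^ d * volume.real (ball (0 : EuclideanSpace ℝ (Fin d)) 1) ≤
      volume.real {y : EuclideanSpace ℝ (Fin d) | r / 2 ≤ ‖y‖ ∧ ‖y‖ ≤ r} := by
  have : Nontrivial (EuclideanSpace ℝ (Fin d)) :=
    Module.nontrivial_of_finrank_pos (R := ℝ) (by rwa [finrank_euclideanSpace_fin])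
  obtain ⟨e, he⟩ := exists_norm_eq (EuclideanSpace ℝ (Fin d)) (by positivity : 0 ≤ 3 * r / 4)
  rw [← volume_real_ball_euclidean hd e (by positivity)]
  refine measureReal_mono (fun y hy => ?_) ?_
  · rw [mem_ball, dist_eq_norm] at hy
    have h1 := norm_sub_norm_le y e
    have h2 := norm_sub_norm_le e y
    rw [norm_sub_rev] at h2
    constructor <;> linarith
  · refine ((measure_mono fun y hy => ?_).trans_lt
      (measure_closedBall_lt_top (x := (0 : EuclideanSpace ℝ (Fin d))) (r := r))).ne
    exact mem_closedBall_zero_iff.2 hy.2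

/-- Averaging over balls of radius `r`: a Tonelli argument. -/
lemma lintegral_ball_le_lintegral_lintegral_ball (hd : 0 < d)
    {h : EuclideanSpace ℝ (Fin d) → ENNReal} (hh : Measurable h)
    (z : EuclideanSpace ℝ (Fin d)) {R r : ℝ} (hr : 0 < r) (hrR : r ≤ R) :
    ENNReal.ofReal (r ^ d * volume.real (ball (0 : EuclideanSpace ℝ (Fin d)) 1)) *
        ∫⁻ x in ball z R, h x ≤
      ∫⁻ w in ball z (2 * R), ∫⁻ x in ball w r, h x := by
  set S : Set (EuclideanSpace ℝ (Fin d) × EuclideanSpace ℝ (Fin d)) :=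
    {p | dist p.1 p.2 < r} with hS
  have hSm : MeasurableSet S := (isOpen_lt continuous_dist continuous_const).measurableSet
  have hmeas : Measurable (S.indicator fun p => h p.1) := (hh.comp measurable_fst).indicator hSm
  have hvol : ∀ x : EuclideanSpace ℝ (Fin d),
      ENNReal.ofReal (r ^ d * volume.real (ball (0 : EuclideanSpace ℝ (Fin d)) 1))
        = volume (ball x r) := fun x => by
    rw [← volume_real_ball_euclidean hd x hr.le, ofReal_measureReal measure_ball_lt_top.ne]
  have h1 : ∀ x ∈ ball z R,
      ENNReal.ofReal (r ^ d * volume.real (ball (0 : EuclideanSpace ℝ (Fin d)) 1)) * h x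
        ≤ ∫⁻ w in ball z (2 * R), S.indicator (fun p => h p.1) (x, w) := by
    intro x hx
    have hsub : ball x r ⊆ ball z (2 * R) := fun w hw => by
      rw [mem_ball] at *
      linarith [dist_triangle w x z]
    calc _ = ∫⁻ w in ball x r, h x := by rw [setLIntegral_const, hvol x, mul_comm]
      _ = ∫⁻ w in ball x r, S.indicator (fun p => h p.1) (x, w) := by
        refine setLIntegral_congr_fun measurableSet_ball fun w hw => ?_
        rw [Set.indicator_of_mem]
        rw [mem_ball, dist_comm] at hw
        exact hw
      _ ≤ _ := lintegral_mono_set hsub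
  calc _ = ∫⁻ x in ball z R,
        ENNReal.ofReal (r ^ d * volume.real (ball (0 : EuclideanSpace ℝ (Fin d)) 1)) * h x :=
        (lintegral_const_mul _ hh).symm
    _ ≤ ∫⁻ x in ball z R, ∫⁻ w in ball z (2 * R), S.indicator (fun p => h p.1) (x, w) :=
        setLIntegral_mono' measurableSet_ball h1
    _ ≤ ∫⁻ x, ∫⁻ w in ball z (2 * R), S.indicator (fun p => h p.1) (x, w) :=
        setLIntegral_le_lintegral _ _
    _ = ∫⁻ w in ball z (2 * R), ∫⁻ x, S.indicator (fun p => h p.1) (x, w) :=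
        lintegral_lintegral_swap hmeas.aemeasurable
    _ = _ := by
        refine lintegral_congr fun w => ?_
        rw [← lintegral_indicator measurableSet_ball]
        rfl

lemma lintegral_Ioo_comp_two_mul (F : ℝ → ENNReal) (R : ℝ) :
    ∫⁻ r in Set.Ioo (0 : ℝ) R, 2 * F (2 * r) = ∫⁻ s in Set.Ioo (0 : ℝ) (2 * R), F s := by
  have hemb : MeasurableEmbedding fun x : ℝ => 2 * x :=
    measurableEmbedding_mulLeft₀ (two_ne_zero : (2 : ℝ) ≠ 0)
  rw [lintegral_const_mul' _ _ (by simp), ← lintegral_indicator measurableSet_Ioo,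
    ← lintegral_indicator measurableSet_Ioo]
  have h1 : ∀ r : ℝ, (Set.Ioo (0 : ℝ) R).indicator (fun r => F (2 * r)) r
      = (Set.Ioo (0 : ℝ) (2 * R)).indicator F (2 * r) := fun r => by
    have : r ∈ Set.Ioo (0 : ℝ) R ↔ 2 * r ∈ Set.Ioo (0 : ℝ) (2 * R) := by simp
    by_cases hr : r ∈ Set.Ioo (0 : ℝ) R
    · rw [Set.indicator_of_mem hr, Set.indicator_of_mem (this.1 hr)]
    · rw [Set.indicator_of_notMem hr, Set.indicator_of_notMem fun h => hr (this.2 h)]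
  rw [lintegral_congr h1, ← hemb.lintegral_map, Real.map_volume_mul_left two_ne_zero,
    lintegral_smul_measure, smul_eq_mul, ← mul_assoc]
  have h2 : (2 : ENNReal) * ENNReal.ofReal |(2 : ℝ)⁻¹| = 1 := by
    rw [← ENNReal.ofReal_ofNat 2, ← ENNReal.ofReal_mul (by norm_num)]
    norm_num
  rw [h2, one_mul]

end Volume

section LocalBound

variable {d : ℕ} {φ f : EuclideanSpace ℝ (Fin d) → ℝ}

lemma measurable_mollifiedGrad (r : ℝ) : Measurable (mollifiedGrad d φ f r) :=
  (InnerProductSpace.toDual ℝ (EuclideanSpace ℝ (Fin d))).symm.continuous.measurable.comp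
    (measurable_fderiv ℝ _)

lemma measurable_nu1tilde (hf : Measurable f) (r : ℝ) :
    Measurable fun x => nu1tilde d φ f x r := by
  have hG := measurable_mollifiedGrad (d := d) (φ := φ) (f := f) r
  have hm : Measurable fun p : EuclideanSpace ℝ (Fin d) × EuclideanSpace ℝ (Fin d) =>
      ((f (p.1 + p.2) - f p.1 - ⟪mollifiedGrad d φ f r p.1, p.2⟫) / r) ^ 2 :=
    ((((hf.comp (measurable_fst.add measurable_snd)).sub (hf.comp measurable_fst)).sub
      ((hG.comp measurable_fst).inner measurable_snd)).div_const r).pow_const 2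
  have hI := (hm.stronglyMeasurable.integral_prod_right' (ν := volume.restrict
    {y : EuclideanSpace ℝ (Fin d) | r / 2 ≤ ‖y‖ ∧ ‖y‖ ≤ r})).measurable
  unfold nu1tilde
  simp_rw [setAverage_eq, smul_eq_mul]
  exact (hI.const_mul _).sqrt

lemma nu1tilde_sq (x : EuclideanSpace ℝ (Fin d)) (r : ℝ) :
    (nu1tilde d φ f x r) ^ 2 =
      (volume.real {y : EuclideanSpace ℝ (Fin d) | r / 2 ≤ ‖y‖ ∧ ‖y‖ ≤ r})⁻¹ *
        ∫ y in {y : EuclideanSpace ℝ (Fin d) | r / 2 ≤ ‖y‖ ∧ ‖y‖ ≤ r},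
          ((f (x + y) - f x - ⟪mollifiedGrad d φ f r x, y⟫) / r) ^ 2 := by
  have h0 : 0 ≤ (volume.real {y : EuclideanSpace ℝ (Fin d) | r / 2 ≤ ‖y‖ ∧ ‖y‖ ≤ r})⁻¹ *
        ∫ y in {y : EuclideanSpace ℝ (Fin d) | r / 2 ≤ ‖y‖ ∧ ‖y‖ ≤ r},
          ((f (x + y) - f x - ⟪mollifiedGrad d φ f r x, y⟫) / r) ^ 2 :=
    mul_nonneg (by positivity) (integral_nonneg fun y => sq_nonneg _)
  rw [nu1tilde, setAverage_eq, smul_eq_mul, Real.sq_sqrt h0]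

lemma sq_sub_sub_inner_le {E : Type*} [NormedAddCommGroup E] [InnerProductSpace ℝ E]
    (s t : ℝ) {v y : E} {r : ℝ} (hy : ‖y‖ ≤ r) :
    (s - t - ⟪v, y⟫) ^ 2 ≤ 3 * (s ^ 2 + (t ^ 2 + ‖v‖ ^ 2 * r ^ 2)) := by
  have h1 : ⟪v, y⟫ ^ 2 ≤ ‖v‖ ^ 2 * r ^ 2 := by
    rw [← sq_abs, ← mul_pow]
    exact pow_le_pow_left₀ (abs_nonneg _)
      ((abs_real_inner_le_norm v y).trans (mul_le_mul_of_nonneg_left hy (norm_nonneg _))) 2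
  nlinarith [sq_nonneg (s + t), sq_nonneg (s + ⟪v, y⟫), sq_nonneg (t - ⟪v, y⟫)]

/-- Pointwise bound for `ν̃₁` through the deviation of `f` from an affine function on a
twice larger ball. -/
lemma nu1tilde_sq_le (hd : 0 < d) {M : ℝ}
    (hM : ∀ r : ℝ, 0 < r → ∀ u : EuclideanSpace ℝ (Fin d),
      ‖fderiv ℝ (fun v => r ^ (-(d : ℝ)) * φ (r⁻¹ • v)) u‖ ≤ M * (r ^ d * r)⁻¹)
    (hφs : ContDiff ℝ (⊤ : ℕ∞) φ)
    (hφsupp : ∀ x ∉ ball (0 : EuclideanSpace ℝ (Fin d)) 1, φ x = 0)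
    (hφint : ∫ x, φ x = 1) (hf : Measurable f)
    (hf2 : LocallyIntegrable (fun x => (f x) ^ 2) volume)
    {κ : ℝ} (hκ : κ = volume.real (ball (0 : EuclideanSpace ℝ (Fin d)) 1))
    {r : ℝ} (hr : 0 < r) {x w : EuclideanSpace ℝ (Fin d)} (hx : x ∈ ball w r)
    (a : EuclideanSpace ℝ (Fin d)) (b : ℝ) :
    (nu1tilde d φ f x r) ^ 2 ≤ 3 * (r ^ 2)⁻¹ *
      ((4 ^ d / κ + M ^ 2 * κ) * (r ^ d)⁻¹ *
        (∫ y in ball w (2 * r), (f y - (⟪a, y⟫ + b)) ^ 2) + (f x - (⟪a, x⟫ + b)) ^ 2) := by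
  set A : Set (EuclideanSpace ℝ (Fin d)) := {y | r / 2 ≤ ‖y‖ ∧ ‖y‖ ≤ r} with hA
  set g : EuclideanSpace ℝ (Fin d) → ℝ := fun y => f y - (⟪a, y⟫ + b) with hg
  set v := mollifiedGrad d φ f r x - a with hv
  set I := ∫ y in ball w (2 * r), (g y) ^ 2 with hI
  have hκ0 : 0 < κ := hκ ▸ volume_real_unitBall_pos
  have hgm : Measurable g := hf.sub (by fun_prop)
  have hg2 : LocallyIntegrable (fun y => (g y) ^ 2) volume :=
    locallyIntegrable_sq_sub hf hf2 (by fun_prop)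
  have hg1 : LocallyIntegrable g volume := locallyIntegrable_of_locallyIntegrable_sq hgm hg2
  have hAm : MeasurableSet A :=
    ((isClosed_le continuous_const continuous_norm).inter
      (isClosed_le continuous_norm continuous_const)).measurableSet
  have hAsub : A ⊆ closedBall 0 r := fun y hy => mem_closedBall_zero_iff.2 hy.2
  have hAfin : volume A ≠ ⊤ := ((measure_mono hAsub).trans_lt measure_closedBall_lt_top).ne
  have hAvol : (r / 4) ^ d * κ ≤ volume.real A := hκ ▸ volume_real_annulus_ge hd hr
  have hApos : 0 < volume.real A := lt_of_lt_of_le (by positivity) hAvol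
  have hcsub : closedBall x r ⊆ ball w (2 * r) := fun y hy => by
    rw [mem_ball] at *
    rw [mem_closedBall] at hy
    linarith [dist_triangle y x w]
  have hballint : IntegrableOn (fun y => (g y) ^ 2) (ball w (2 * r)) volume :=
    (hg2.integrableOn_isCompact (isCompact_closedBall w (2 * r))).mono_set ball_subset_closedBall
  have hIc : ∫ y in closedBall x r, (g y) ^ 2 ≤ I :=
    setIntegral_mono_set hballint (Filter.Eventually.of_forall fun y => sq_nonneg _)
      hcsub.eventuallyLE
  have hI0 : 0 ≤ I := integral_nonneg fun y => sq_nonneg _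
  have hpre : (fun y => x + y) ⁻¹' closedBall x r = closedBall 0 r := by
    rw [preimage_add_closedBall, sub_self]
  have hshift_int : IntegrableOn (fun y => (g (x + y)) ^ 2) (closedBall 0 r) volume := by
    rw [← hpre]
    exact ((measurePreserving_add_left volume x).integrableOn_comp_preimage
      (measurableEmbedding_addLeft x) (f := fun y => (g y) ^ 2)).2
      (hballint.mono_set hcsub)
  have hshift : ∫ y in A, (g (x + y)) ^ 2 ≤ I := by
    calc ∫ y in A, (g (x + y)) ^ 2 ≤ ∫ y in closedBall 0 r, (g (x + y)) ^ 2 :=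
          setIntegral_mono_set hshift_int (Filter.Eventually.of_forall fun y => sq_nonneg _)
            hAsub.eventuallyLE
      _ = ∫ y in closedBall x r, (g y) ^ 2 := by
          rw [← hpre]
          exact (measurePreserving_add_left volume x).setIntegral_preimage_emb
            (measurableEmbedding_addLeft x) (fun y => (g y) ^ 2) _
      _ ≤ I := hIc
  have hvb : ‖v‖ ^ 2 * r ^ 2 ≤ M ^ 2 * κ * (r ^ d)⁻¹ * I := by
    have h1 : ‖v‖ ≤ M * (r ^ d * r)⁻¹ * ∫ y in closedBall x r, |g y| :=
      norm_mollifiedGrad_sub_le hM hφs hφsupp hφint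
        (locallyIntegrable_of_locallyIntegrable_sq hf hf2) hr x a b
    have hvolc : volume.real (closedBall x r) = r ^ d * κ := by
      rw [Measure.addHaar_real_closedBall _ _ hr.le, finrank_euclideanSpace_fin, hκ]
    have h2 : (∫ y in closedBall x r, |g y|) ^ 2 ≤ (r ^ d * κ) * I := by
      refine (sq_setIntegral_abs_le measure_closedBall_lt_top.ne ?_
        (hg1.integrableOn_isCompact (isCompact_closedBall x r))
        (hg2.integrableOn_isCompact (isCompact_closedBall x r))).trans ?_
      · rw [hvolc]; positivity
      · rw [hvolc]
        exact mul_le_mul_of_nonneg_left hIc (by positivity)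
    calc ‖v‖ ^ 2 * r ^ 2
        ≤ (M * (r ^ d * r)⁻¹ * ∫ y in closedBall x r, |g y|) ^ 2 * r ^ 2 := by gcongr
      _ = M ^ 2 * ((r ^ d * r)⁻¹) ^ 2 * (∫ y in closedBall x r, |g y|) ^ 2 * r ^ 2 := by ring
      _ ≤ M ^ 2 * ((r ^ d * r)⁻¹) ^ 2 * ((r ^ d * κ) * I) * r ^ 2 := by gcongr
      _ = M ^ 2 * κ * (r ^ d)⁻¹ * I := by field_simp
  have hAinv : (volume.real A)⁻¹ ≤ 4 ^ d / κ * (r ^ d)⁻¹ := by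
    refine (inv_anti₀ (by positivity) hAvol).trans_eq ?_
    rw [div_pow]; field_simp
  have hbound_int : IntegrableOn (fun y => 3 * (r ^ 2)⁻¹ *
      ((g (x + y)) ^ 2 + ((g x) ^ 2 + ‖v‖ ^ 2 * r ^ 2))) A volume :=
    ((hshift_int.mono_set hAsub).add (integrableOn_const hAfin)).const_mul _
  have hint : ∫ y in A, ((f (x + y) - f x - ⟪mollifiedGrad d φ f r x, y⟫) / r) ^ 2
      ≤ 3 * (r ^ 2)⁻¹ * (I + volume.real A * ((g x) ^ 2 + ‖v‖ ^ 2 * r ^ 2)) := by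
    calc _ ≤ ∫ y in A, 3 * (r ^ 2)⁻¹ * ((g (x + y)) ^ 2 + ((g x) ^ 2 + ‖v‖ ^ 2 * r ^ 2)) := by
          refine integral_mono_of_nonneg (Filter.Eventually.of_forall fun y => sq_nonneg _)
            hbound_int ?_
          filter_upwards [ae_restrict_mem hAm] with y hy
          have h1 : f (x + y) - f x - ⟪mollifiedGrad d φ f r x, y⟫
              = g (x + y) - g x - ⟪v, y⟫ := by
            simp only [hg, hv, inner_sub_left, inner_add_right]; ring
          rw [h1, div_pow, div_eq_mul_inv]
          calc _ ≤ 3 * ((g (x + y)) ^ 2 + ((g x) ^ 2 + ‖v‖ ^ 2 * r ^ 2)) * (r ^ 2)⁻¹ :=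
                mul_le_mul_of_nonneg_right (sq_sub_sub_inner_le _ _ hy.2) (by positivity)
            _ = _ := by ring
      _ = 3 * (r ^ 2)⁻¹ * ((∫ y in A, (g (x + y)) ^ 2)
            + volume.real A * ((g x) ^ 2 + ‖v‖ ^ 2 * r ^ 2)) := by
          rw [integral_const_mul, integral_add (hshift_int.mono_set hAsub)
            (integrableOn_const hAfin), setIntegral_const, smul_eq_mul]
      _ ≤ _ := by gcongr
  rw [nu1tilde_sq]
  calc _ ≤ (volume.real A)⁻¹ *
          (3 * (r ^ 2)⁻¹ * (I + volume.real A * ((g x) ^ 2 + ‖v‖ ^ 2 * r ^ 2))) := by gcongr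
    _ = 3 * (r ^ 2)⁻¹ * ((volume.real A)⁻¹ * I + ((g x) ^ 2 + ‖v‖ ^ 2 * r ^ 2)) := by
        field_simp
    _ ≤ 3 * (r ^ 2)⁻¹ * (4 ^ d / κ * (r ^ d)⁻¹ * I
          + ((g x) ^ 2 + M ^ 2 * κ * (r ^ d)⁻¹ * I)) := by gcongr
    _ = _ := by ring

/-- The averaged form of the local bound, for a fixed affine function. -/
lemma lintegral_nu1tilde_sq_le_average (hd : 0 < d) {M : ℝ}
    (hM : ∀ r : ℝ, 0 < r → ∀ u : EuclideanSpace ℝ (Fin d),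
      ‖fderiv ℝ (fun v => r ^ (-(d : ℝ)) * φ (r⁻¹ • v)) u‖ ≤ M * (r ^ d * r)⁻¹)
    (hφs : ContDiff ℝ (⊤ : ℕ∞) φ)
    (hφsupp : ∀ x ∉ ball (0 : EuclideanSpace ℝ (Fin d)) 1, φ x = 0)
    (hφint : ∫ x, φ x = 1) (hf : Measurable f)
    (hf2 : LocallyIntegrable (fun x => (f x) ^ 2) volume)
    {κ : ℝ} (hκ : κ = volume.real (ball (0 : EuclideanSpace ℝ (Fin d)) 1))
    {r : ℝ} (hr : 0 < r) (w a : EuclideanSpace ℝ (Fin d)) (b : ℝ) :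
    ∫⁻ x in ball w r, ENNReal.ofReal ((nu1tilde d φ f x r) ^ 2) ≤
      ENNReal.ofReal (12 * ((4 ^ d / κ + M ^ 2 * κ) * κ + 1) * κ * 2 ^ d * r ^ d *
        ⨍ y in ball w (2 * r), ((f y - (⟪a, y⟫ + b)) / (2 * r)) ^ 2) := by
  have hκ0 : 0 < κ := hκ ▸ volume_real_unitBall_pos
  have hg2 : LocallyIntegrable (fun y => (f y - (⟪a, y⟫ + b)) ^ 2) volume :=
    locallyIntegrable_sq_sub hf hf2 (by fun_prop)
  have hballint : IntegrableOn (fun y => (f y - (⟪a, y⟫ + b)) ^ 2) (ball w (2 * r)) volume :=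
    (hg2.integrableOn_isCompact (isCompact_closedBall w (2 * r))).mono_set ball_subset_closedBall
  have hsub : ball w r ⊆ ball w (2 * r) := ball_subset_ball (by linarith)
  have hmono : ∫ y in ball w r, (f y - (⟪a, y⟫ + b)) ^ 2
      ≤ ∫ y in ball w (2 * r), (f y - (⟪a, y⟫ + b)) ^ 2 :=
    setIntegral_mono_set hballint (Filter.Eventually.of_forall fun y => sq_nonneg _)
      hsub.eventuallyLE
  set I := ∫ y in ball w (2 * r), (f y - (⟪a, y⟫ + b)) ^ 2 with hI
  set c := (4 ^ d / κ + M ^ 2 * κ) with hc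
  have hI0 : 0 ≤ I := integral_nonneg fun y => sq_nonneg _
  have hc0 : 0 ≤ c := by positivity
  have hconst : IntegrableOn (fun _ : EuclideanSpace ℝ (Fin d) => c * (r ^ d)⁻¹ * I)
      (ball w r) volume := integrableOn_const measure_ball_lt_top.ne
  have hbint : IntegrableOn (fun x => 3 * (r ^ 2)⁻¹ *
      (c * (r ^ d)⁻¹ * I + (f x - (⟪a, x⟫ + b)) ^ 2)) (ball w r) volume :=
    (hconst.add (hballint.mono_set hsub)).const_mul _
  calc _ ≤ ∫⁻ x in ball w r, ENNReal.ofReal (3 * (r ^ 2)⁻¹ *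
          (c * (r ^ d)⁻¹ * I + (f x - (⟪a, x⟫ + b)) ^ 2)) :=
        setLIntegral_mono' measurableSet_ball fun x hx => ENNReal.ofReal_le_ofReal
          (nu1tilde_sq_le hd hM hφs hφsupp hφint hf hf2 hκ hr hx a b)
    _ = ENNReal.ofReal (∫ x in ball w r, 3 * (r ^ 2)⁻¹ *
          (c * (r ^ d)⁻¹ * I + (f x - (⟪a, x⟫ + b)) ^ 2)) :=
        (ofReal_integral_eq_lintegral_ofReal hbint
          (Filter.Eventually.of_forall fun x => by positivity)).symm
    _ ≤ _ := by
        refine ENNReal.ofReal_le_ofReal ?_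
        rw [integral_const_mul, integral_add hconst (hballint.mono_set hsub),
          setIntegral_const, smul_eq_mul,
          volume_real_ball_euclidean hd w hr.le, ← hκ, setAverage_eq, smul_eq_mul,
          volume_real_ball_euclidean hd w (by positivity : 0 ≤ 2 * r), ← hκ]
        simp_rw [div_pow]
        rw [integral_div, ← hI]
        calc _ ≤ 3 * (r ^ 2)⁻¹ * (r ^ d * κ * (c * (r ^ d)⁻¹ * I) + I) := by gcongr
          _ = _ := by
            rw [mul_pow]
            field_simp
            ring

lemma lintegral_nu1tilde_sq_le (hd : 0 < d) {M : ℝ}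
    (hM : ∀ r : ℝ, 0 < r → ∀ u : EuclideanSpace ℝ (Fin d),
      ‖fderiv ℝ (fun v => r ^ (-(d : ℝ)) * φ (r⁻¹ • v)) u‖ ≤ M * (r ^ d * r)⁻¹)
    (hφs : ContDiff ℝ (⊤ : ℕ∞) φ)
    (hφsupp : ∀ x ∉ ball (0 : EuclideanSpace ℝ (Fin d)) 1, φ x = 0)
    (hφint : ∫ x, φ x = 1) (hf : Measurable f)
    (hf2 : LocallyIntegrable (fun x => (f x) ^ 2) volume)
    {κ : ℝ} (hκ : κ = volume.real (ball (0 : EuclideanSpace ℝ (Fin d)) 1))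
    {r : ℝ} (hr : 0 < r) (w : EuclideanSpace ℝ (Fin d)) :
    ∫⁻ x in ball w r, ENNReal.ofReal ((nu1tilde d φ f x r) ^ 2) ≤
      ENNReal.ofReal (12 * ((4 ^ d / κ + M ^ 2 * κ) * κ + 1) * κ * 2 ^ d * r ^ d *
        (nu1 d f w (2 * r)) ^ 2) := by
  have hκ0 : 0 < κ := hκ ▸ volume_real_unitBall_pos
  set B := 12 * ((4 ^ d / κ + M ^ 2 * κ) * κ + 1) * κ * 2 ^ d * r ^ d with hB
  have hB0 : 0 < B := by positivity
  have h := fun p : EuclideanSpace ℝ (Fin d) × ℝ =>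
    lintegral_nu1tilde_sq_le_average hd hM hφs hφsupp hφint hf hf2 hκ hr w p.1 p.2
  set L := ∫⁻ x in ball w r, ENNReal.ofReal ((nu1tilde d φ f x r) ^ 2) with hL
  have hLfin : L ≠ ⊤ := ((h 0).trans_lt ENNReal.ofReal_lt_top).ne
  have hle : Real.sqrt (L.toReal / B) ≤ nu1 d f w (2 * r) := by
    refine le_ciInf fun p => Real.sqrt_le_sqrt ?_
    rw [div_le_iff₀ hB0, mul_comm]
    refine ENNReal.toReal_le_of_le_ofReal (mul_nonneg hB0.le ?_) (h p)
    rw [setAverage_eq, smul_eq_mul]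
    exact mul_nonneg (by positivity) (integral_nonneg fun y => sq_nonneg _)
  have hsq : L.toReal / B ≤ (nu1 d f w (2 * r)) ^ 2 := by
    rw [← Real.sq_sqrt (by positivity : 0 ≤ L.toReal / B)]
    exact pow_le_pow_left₀ (Real.sqrt_nonneg _) hle 2
  rw [← ENNReal.ofReal_toReal hLfin]
  refine ENNReal.ofReal_le_ofReal ?_
  rwa [div_le_iff₀ hB0, mul_comm] at hsq

end LocalBound

/-- For `1 ≤ α < 2`, the square function bound for `ν₁` implies the square
function bound for `ν̃₁` (defined with approximate Taylor polynomials built from a fixed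
mollifier `φ`), with constant multiplied by a factor depending only on `d`, `α` and `φ`. -/
theorem nu1_square_function_implies_nu1tilde (d : ℕ) (hd : 0 < d)
    (α : ℝ) (hα0 : 1 ≤ α) (hα1 : α < 2)
    (φ : EuclideanSpace ℝ (Fin d) → ℝ) (hφs : ContDiff ℝ (⊤ : ℕ∞) φ) (hφ0 : ∀ x, 0 ≤ φ x)
    (hφsupp : ∀ x ∉ ball (0 : EuclideanSpace ℝ (Fin d)) 1, φ x = 0)
    (hφint : ∫ x, φ x = 1) :
    ∃ C : ℝ, 0 < C ∧
      ∀ (f : EuclideanSpace ℝ (Fin d) → ℝ) (C₁ : ℝ), Measurable f →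
        LocallyIntegrable (fun x => (f x) ^ 2) volume → 0 ≤ C₁ →
        (∀ (z : EuclideanSpace ℝ (Fin d)) (R : ℝ), 0 < R →
          (∫⁻ r in Set.Ioo (0 : ℝ) R,
            (∫⁻ x in ball z R,
              ENNReal.ofReal ((nu1 d f x r / r ^ (α - 1)) ^ 2)) / ENNReal.ofReal r)
            ≤ ENNReal.ofReal (C₁ * R ^ (d : ℕ))) →
        ∀ (z : EuclideanSpace ℝ (Fin d)) (R : ℝ), 0 < R →
          (∫⁻ r in Set.Ioo (0 : ℝ) R,
            (∫⁻ x in ball z R,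
              ENNReal.ofReal ((nu1tilde d φ f x r / r ^ (α - 1)) ^ 2)) / ENNReal.ofReal r)
            ≤ ENNReal.ofReal (C * C₁ * R ^ (d : ℕ)) := by
  obtain ⟨M, hM⟩ := exists_fderiv_rescaled_bound hφs
    (hasCompactSupport_of_eq_zero_off_ball hφsupp)
  obtain ⟨κ, hκ⟩ : ∃ κ : ℝ, κ = volume.real (ball (0 : EuclideanSpace ℝ (Fin d)) 1) := ⟨_, rfl⟩
  have hκ0 : 0 < κ := hκ ▸ volume_real_unitBall_pos
  obtain ⟨B, hB0, hB⟩ : ∃ B : ℝ, 0 < B ∧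
      B = 12 * ((4 ^ d / κ + M ^ 2 * κ) * κ + 1) * κ * 2 ^ d := ⟨_, by positivity, rfl⟩
  have hq0 : (0 : ℝ) < 2 ^ (α - 1) := by positivity
  refine ⟨B * (2 ^ (α - 1)) ^ 2 / κ * 2 ^ d, by positivity, ?_⟩
  intro f C₁ hf hf2 hC₁ hnu z R hR
  set F : ℝ → ENNReal := fun s => (∫⁻ x in ball z (2 * R),
    ENNReal.ofReal ((nu1 d f x s / s ^ (α - 1)) ^ 2)) / ENNReal.ofReal s with hF
  have hslice : ∀ r ∈ Set.Ioo (0 : ℝ) R,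
      (∫⁻ x in ball z R, ENNReal.ofReal ((nu1tilde d φ f x r / r ^ (α - 1)) ^ 2))
        / ENNReal.ofReal r
      ≤ ENNReal.ofReal (B * (2 ^ (α - 1)) ^ 2 / κ) * (2 * F (2 * r)) := by
    intro r hr
    have hr0 : 0 < r := hr.1
    have hρ0 : 0 < r ^ (α - 1) := by positivity
    have h2ρ : (2 * r) ^ (α - 1) = 2 ^ (α - 1) * r ^ (α - 1) :=
      Real.mul_rpow (by norm_num) hr0.le
    have htonelli := lintegral_ball_le_lintegral_lintegral_ball hd
      (h := fun x => ENNReal.ofReal ((nu1tilde d φ f x r / r ^ (α - 1)) ^ 2))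
      ((((measurable_nu1tilde hf r).div_const _).pow_const 2).ennreal_ofReal) z hr0 hr.2.le
    have hlocal : ∀ w, ∫⁻ x in ball w r,
          ENNReal.ofReal ((nu1tilde d φ f x r / r ^ (α - 1)) ^ 2)
        ≤ ENNReal.ofReal (B * (2 ^ (α - 1)) ^ 2 * r ^ d) *
          ENNReal.ofReal ((nu1 d f w (2 * r) / (2 * r) ^ (α - 1)) ^ 2) := by
      intro w
      have h1 := lintegral_nu1tilde_sq_le hd hM hφs hφsupp hφint hf hf2 hκ hr0 w
      rw [← hB] at h1
      have h2 : ∀ x, ENNReal.ofReal ((nu1tilde d φ f x r / r ^ (α - 1)) ^ 2)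
          = ENNReal.ofReal (((r ^ (α - 1)) ^ 2)⁻¹) *
            ENNReal.ofReal ((nu1tilde d φ f x r) ^ 2) := fun x => by
        rw [← ENNReal.ofReal_mul (by positivity), div_pow, div_eq_inv_mul]
      simp_rw [h2]
      rw [lintegral_const_mul' _ _ ENNReal.ofReal_ne_top]
      refine (mul_le_mul_right h1 _).trans_eq ?_
      rw [← ENNReal.ofReal_mul (by positivity), ← ENNReal.ofReal_mul (by positivity), h2ρ]
      congr 1
      field_simp
    have hmain : ∫⁻ x in ball z R, ENNReal.ofReal ((nu1tilde d φ f x r / r ^ (α - 1)) ^ 2)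
        ≤ ENNReal.ofReal (B * (2 ^ (α - 1)) ^ 2 / κ) * ∫⁻ w in ball z (2 * R),
          ENNReal.ofReal ((nu1 d f w (2 * r) / (2 * r) ^ (α - 1)) ^ 2) := by
      rw [← ENNReal.mul_le_mul_iff_right (a := ENNReal.ofReal (r ^ d * κ))
        (by simpa using (by positivity : 0 < r ^ d * κ)) ENNReal.ofReal_ne_top, ← mul_assoc,
        ← ENNReal.ofReal_mul (by positivity)]
      have hc : r ^ d * κ * (B * (2 ^ (α - 1)) ^ 2 / κ) = B * (2 ^ (α - 1)) ^ 2 * r ^ d := by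
        field_simp
      rw [← hκ] at htonelli
      rw [hc]
      refine htonelli.trans ((lintegral_mono hlocal).trans_eq ?_)
      rw [lintegral_const_mul' _ _ ENNReal.ofReal_ne_top]
    have hFr : 2 * F (2 * r) = (∫⁻ w in ball z (2 * R),
        ENNReal.ofReal ((nu1 d f w (2 * r) / (2 * r) ^ (α - 1)) ^ 2)) / ENNReal.ofReal r := by
      simp only [hF]
      rw [ENNReal.ofReal_mul (by norm_num), ENNReal.ofReal_ofNat, ← mul_div_assoc,
        ENNReal.mul_div_mul_left _ _ (by norm_num) (by norm_num)]
    rw [hFr, ← mul_div_assoc]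
    exact ENNReal.div_le_div_right hmain _
  calc _ ≤ ∫⁻ r in Set.Ioo (0 : ℝ) R,
          ENNReal.ofReal (B * (2 ^ (α - 1)) ^ 2 / κ) * (2 * F (2 * r)) :=
        setLIntegral_mono' measurableSet_Ioo hslice
    _ = ENNReal.ofReal (B * (2 ^ (α - 1)) ^ 2 / κ) * ∫⁻ s in Set.Ioo (0 : ℝ) (2 * R), F s := by
        rw [lintegral_const_mul' _ _ ENNReal.ofReal_ne_top, lintegral_Ioo_comp_two_mul]
    _ ≤ ENNReal.ofReal (B * (2 ^ (α - 1)) ^ 2 / κ) * ENNReal.ofReal (C₁ * (2 * R) ^ d) :=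
        mul_le_mul_right (hnu z (2 * R) (by positivity)) _
    _ = _ := by
        rw [← ENNReal.ofReal_mul (by positivity)]
        congr 1
        rw [mul_pow]; ring
end

section
/- Let d ≥ 1, 0 < α < 1, and let f : ℝ^d → ℝ be locally square-integrable. Suppose there is C₁ < ∞ such that for every z ∈ ℝ^d and R > 0, ∫_0^R ∫_{B_R(z)} ( ν₀^f(x,r) / r^{α−1} )² dx dr/r ≤ C₁ R^d. Then there is a constant C depending only on d and α such that for every z ∈ ℝ^d and R > 0, ∫_{B_R(z)} ∫_{|y| ≤ R} |f(x) − f(x+y)|² / |y|^{d+2α} dy dx ≤ C C₁ R^d. (By Strichartz's characterization, this conclusion means f ∈ I_α(BMO) with ‖D_α f‖_*² ≲ C₁.) -/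
open MeasureTheory Metric

/-- `ν₀^f(x,r)`: the best `L²`-approximation of `f` by constants on `B_r(x)`, normalized by `r`. -/
noncomputable def nu0 (d : ℕ) (f : EuclideanSpace ℝ (Fin d) → ℝ)
    (x : EuclideanSpace ℝ (Fin d)) (r : ℝ) : ℝ :=
  ⨅ c : ℝ, Real.sqrt (⨍ y in ball x r, ((f y - c) / r) ^ 2)

open Set in
/-- On a set of finite measure, the double integral of `|f x - f w|²` is controlled by the
integral of `|f - c|²`. -/
theorem lintegral_prod_sq_sub_le {E : Type*} [MeasurableSpace E] (μ : Measure E) [SFinite μ]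
    {f : E → ℝ} (hf : Measurable f) (c : ℝ) :
    ∫⁻ q, ENNReal.ofReal (|f q.1 - f q.2| ^ 2) ∂(μ.prod μ) ≤
      4 * μ univ * ∫⁻ y, ENNReal.ofReal ((f y - c) ^ 2) ∂μ := by
  have hm : Measurable fun y => 2 * ENNReal.ofReal ((f y - c) ^ 2) := by fun_prop
  calc ∫⁻ q, ENNReal.ofReal (|f q.1 - f q.2| ^ 2) ∂(μ.prod μ)
      ≤ ∫⁻ x, ∫⁻ w, ENNReal.ofReal (|f x - f w| ^ 2) ∂μ ∂μ := lintegral_prod_le _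
    _ ≤ ∫⁻ x, ∫⁻ w, (2 * ENNReal.ofReal ((f x - c) ^ 2)
          + 2 * ENNReal.ofReal ((f w - c) ^ 2)) ∂μ ∂μ := by
        gcongr with x w
        rw [← ENNReal.ofReal_ofNat 2, ← ENNReal.ofReal_mul (by norm_num),
          ← ENNReal.ofReal_mul (by norm_num), ← ENNReal.ofReal_add (by positivity) (by positivity)]
        apply ENNReal.ofReal_le_ofReal
        rw [sq_abs]
        nlinarith [sq_nonneg (f x - c + (f w - c))]
    _ = 4 * μ univ * ∫⁻ y, ENNReal.ofReal ((f y - c) ^ 2) ∂μ := by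
        simp_rw [lintegral_add_left measurable_const, lintegral_const]
        rw [lintegral_add_left (hm.mul_const _), lintegral_mul_const _ hm, lintegral_const,
          lintegral_const_mul _ (by fun_prop)]
        ring

theorem memLp_two_restrict_ball {d : ℕ} {f : EuclideanSpace ℝ (Fin d) → ℝ} (hf : Measurable f)
    (hf2 : LocallyIntegrable (fun x => (f x) ^ 2) volume) (u : EuclideanSpace ℝ (Fin d)) (r : ℝ) :
    MemLp f 2 (volume.restrict (ball u r)) := by
  rw [memLp_two_iff_integrable_sq hf.aestronglyMeasurable]
  exact (hf2.integrableOn_isCompact (isCompact_closedBall u r)).mono_set ball_subset_closedBall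

theorem lintegral_prod_sq_sub_le_nu0 {d : ℕ} {f : EuclideanSpace ℝ (Fin d) → ℝ}
    (hf : Measurable f) (hf2 : LocallyIntegrable (fun x => (f x) ^ 2) volume)
    (u : EuclideanSpace ℝ (Fin d)) {r : ℝ} (hr : 0 < r) :
    ENNReal.ofReal (1 / (4 * volume.real (ball u r) ^ 2 * r ^ 2)) *
      ∫⁻ q in ball u r ×ˢ ball u r, ENNReal.ofReal (|f q.1 - f q.2| ^ 2) ≤
      ENNReal.ofReal (nu0 d f u r ^ 2) := by
  set B := ball u r with hB
  set V := volume.real B with hV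
  have hVt : volume B ≠ ⊤ := measure_ball_lt_top.ne
  have hV0 : 0 < V := ENNReal.toReal_pos (measure_ball_pos _ _ hr).ne' hVt
  set I := ∫⁻ q in B ×ˢ B, ENNReal.ofReal (|f q.1 - f q.2| ^ 2) with hI
  have hint : ∀ c : ℝ, Integrable (fun y => (f y - c) ^ 2) (volume.restrict B) := by
    intro c
    have : IsFiniteMeasure (volume.restrict B) := ⟨by simpa using hVt.lt_top⟩
    exact ((memLp_two_restrict_ball hf hf2 u r).sub (memLp_const c)).integrable_sq
  have hle : ∀ c : ℝ, I ≤ ENNReal.ofReal (4 * V * ∫ y in B, (f y - c) ^ 2) := by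
    intro c
    have h := lintegral_prod_sq_sub_le (volume.restrict B) hf c
    rw [Measure.prod_restrict, Measure.restrict_apply_univ,
      ← ofReal_integral_eq_lintegral_ofReal (hint c) (ae_of_all _ fun y => sq_nonneg _),
      ← ENNReal.ofReal_toReal hVt, ← ENNReal.ofReal_ofNat 4, ← ENNReal.ofReal_mul (by norm_num),
      ← ENNReal.ofReal_mul (by positivity)] at h
    exact h
  have hIt : I ≠ ⊤ := ((hle 0).trans_lt ENNReal.ofReal_lt_top).ne
  have hIr : ∀ c : ℝ, I.toReal ≤ 4 * V * ∫ y in B, (f y - c) ^ 2 := fun c =>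
    ENNReal.toReal_le_of_le_ofReal
      (mul_nonneg (by positivity) (integral_nonneg fun y => sq_nonneg _)) (hle c)
  rw [← ENNReal.ofReal_toReal hIt, ← ENNReal.ofReal_mul (by positivity)]
  apply ENNReal.ofReal_le_ofReal
  have hs : Real.sqrt (1 / (4 * V ^ 2 * r ^ 2) * I.toReal) ≤ nu0 d f u r := by
    apply le_ciInf
    intro c
    apply Real.sqrt_le_sqrt
    rw [setAverage_eq]
    simp_rw [div_pow]
    rw [integral_div, smul_eq_mul, ← hV]
    calc 1 / (4 * V ^ 2 * r ^ 2) * I.toReal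
        ≤ 1 / (4 * V ^ 2 * r ^ 2) * (4 * V * ∫ y in B, (f y - c) ^ 2) := by
          gcongr; exact hIr c
      _ = V⁻¹ * ((∫ y in B, (f y - c) ^ 2) / r ^ 2) := by
          field_simp
  calc _ = Real.sqrt (1 / (4 * V ^ 2 * r ^ 2) * I.toReal) ^ 2 := by
        rw [Real.sq_sqrt]; positivity
    _ ≤ _ := by gcongr

/-- The weight `r ^ (-2α-1) / (4 |B_r|²)`, where `v = |B_1|`. -/
noncomputable def sqWeight (d : ℕ) (α v r : ℝ) : ℝ :=
  r ^ (-2 * α - 1) / (4 * (v * r ^ d) ^ 2)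

theorem volumeReal_ball {d : ℕ} (u : EuclideanSpace ℝ (Fin d)) {r : ℝ} (hr : 0 < r) :
    volume.real (ball u r) =
      volume.real (ball (0 : EuclideanSpace ℝ (Fin d)) 1) * r ^ d := by
  rw [measureReal_def, Measure.addHaar_ball_of_pos _ _ hr, ENNReal.toReal_mul,
    ENNReal.toReal_ofReal (by positivity), finrank_euclideanSpace_fin, mul_comm]
  rfl

theorem sqWeight_mul_lintegral_le {d : ℕ} {α : ℝ} {f : EuclideanSpace ℝ (Fin d) → ℝ}
    (hf : Measurable f) (hf2 : LocallyIntegrable (fun x => (f x) ^ 2) volume)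
    (u : EuclideanSpace ℝ (Fin d)) {r : ℝ} (hr : 0 < r) :
    ENNReal.ofReal (sqWeight d α (volume.real (ball (0 : EuclideanSpace ℝ (Fin d)) 1)) r) *
      ∫⁻ q in ball u r ×ˢ ball u r, ENNReal.ofReal (|f q.1 - f q.2| ^ 2) ≤
      ENNReal.ofReal ((nu0 d f u r / r ^ (α - 1)) ^ 2) * (ENNReal.ofReal r)⁻¹ := by
  have h := lintegral_prod_sq_sub_le_nu0 hf hf2 u hr
  have hrp : r ^ (-2 * α - 1) = ((r ^ α) ^ 2)⁻¹ / r := by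
    rw [Real.rpow_sub_one hr.ne', ← Real.rpow_natCast (r ^ α), ← Real.rpow_mul hr.le,
      ← Real.rpow_neg hr.le]
    congr 2
    push_cast
    ring
  have e : sqWeight d α (volume.real (ball (0 : EuclideanSpace ℝ (Fin d)) 1)) r =
      1 / (r ^ (α - 1)) ^ 2 * r⁻¹ * (1 / (4 * volume.real (ball u r) ^ 2 * r ^ 2)) := by
    rw [sqWeight, hrp, ← volumeReal_ball u hr, Real.rpow_sub_one hr.ne']
    have := (Real.rpow_pos_of_pos hr α).ne'
    field_simp
  rw [e, ENNReal.ofReal_mul (by positivity), mul_assoc]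
  refine (mul_le_mul_right h _).trans_eq ?_
  rw [← ENNReal.ofReal_inv_of_pos hr, ← ENNReal.ofReal_mul (by positivity),
    ← ENNReal.ofReal_mul (by positivity)]
  congr 1
  ring

/-- The pairs `(r, u)` with `0 < r < ρ` and `u ∈ B_ρ(z)` such that `B_r(u)` contains both
components of `q`. -/
def scaleCenters {d : ℕ} (z : EuclideanSpace ℝ (Fin d)) (ρ : ℝ)
    (q : EuclideanSpace ℝ (Fin d) × EuclideanSpace ℝ (Fin d)) :
    Set (ℝ × EuclideanSpace ℝ (Fin d)) :=
  {p | p.1 ∈ Set.Ioo 0 ρ ∧ p.2 ∈ ball z ρ ∧ q ∈ ball p.2 p.1 ×ˢ ball p.2 p.1}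

theorem measurableSet_scaleCenters {d : ℕ} (z : EuclideanSpace ℝ (Fin d)) (ρ : ℝ) :
    MeasurableSet {a : (ℝ × EuclideanSpace ℝ (Fin d)) ×
      (EuclideanSpace ℝ (Fin d) × EuclideanSpace ℝ (Fin d)) |
        a.1 ∈ scaleCenters z ρ a.2} := by
  simp only [scaleCenters, Set.mem_Ioo, mem_ball, Set.mem_prod, Set.mem_ofPred_eq]
  apply IsOpen.measurableSet
  refine IsOpen.and (IsOpen.and ?_ ?_) (IsOpen.and ?_ (IsOpen.and ?_ ?_)) <;>
    exact isOpen_lt (by fun_prop) (by fun_prop)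

theorem measurableSet_scaleCenters_apply {d : ℕ} (z : EuclideanSpace ℝ (Fin d)) (ρ : ℝ)
    (q : EuclideanSpace ℝ (Fin d) × EuclideanSpace ℝ (Fin d)) :
    MeasurableSet (scaleCenters z ρ q) :=
  (measurableSet_scaleCenters z ρ).preimage (measurable_id.prodMk measurable_const)

theorem measurable_indicator_scaleCenters {d : ℕ} (α v : ℝ) (z : EuclideanSpace ℝ (Fin d))
    (ρ : ℝ) :
    Measurable fun a : (ℝ × EuclideanSpace ℝ (Fin d)) ×
      (EuclideanSpace ℝ (Fin d) × EuclideanSpace ℝ (Fin d)) =>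
        (scaleCenters z ρ a.2).indicator (fun p => ENNReal.ofReal (sqWeight d α v p.1)) a.1 := by
  have hw : Measurable fun r => sqWeight d α v r := by unfold sqWeight; fun_prop
  exact Measurable.indicator
    (f := fun a : (ℝ × EuclideanSpace ℝ (Fin d)) ×
      (EuclideanSpace ℝ (Fin d) × EuclideanSpace ℝ (Fin d)) =>
        ENNReal.ofReal (sqWeight d α v a.1.1))
    (by fun_prop) (measurableSet_scaleCenters z ρ)

theorem measurable_lintegral_scaleCenters {d : ℕ} (α v : ℝ) (z : EuclideanSpace ℝ (Fin d))
    (ρ : ℝ) :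
    Measurable fun q => ∫⁻ p in scaleCenters z ρ q, ENNReal.ofReal (sqWeight d α v p.1) := by
  simp_rw [← lintegral_indicator (measurableSet_scaleCenters_apply z ρ _)]
  exact (measurable_indicator_scaleCenters α v z ρ).lintegral_prod_left'

theorem sqWeight_anti {d : ℕ} {α v r s : ℝ} (hα : 0 < α) (hv : 0 < v) (hr : 0 < r)
    (hrs : r ≤ s) : sqWeight d α v s ≤ sqWeight d α v r := by
  unfold sqWeight
  have : s ^ (-2 * α - 1) ≤ r ^ (-2 * α - 1) :=
    Real.rpow_le_rpow_of_nonpos hr hrs (by linarith)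
  gcongr

theorem div_rpow_le_lintegral_scaleCenters {d : ℕ} {α : ℝ} (hα : 0 < α)
    {z x w : EuclideanSpace ℝ (Fin d)} {R : ℝ} (hx : x ∈ ball z R) (hxw : x ≠ w)
    (hw : dist x w ≤ R) {v : ℝ} (hv : v = volume.real (ball (0 : EuclideanSpace ℝ (Fin d)) 1)) :
    ENNReal.ofReal (2 ^ (-2 * α - 1) / (4 * v * 8 ^ d) / dist x w ^ (d + 2 * α)) ≤
      ∫⁻ p in scaleCenters z (4 * R) (x, w), ENNReal.ofReal (sqWeight d α v p.1) := by
  have hv0 : 0 < v := by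
    rw [hv]
    exact ENNReal.toReal_pos (measure_ball_pos _ _ one_pos).ne' measure_ball_lt_top.ne
  set s := dist x w with hs
  have hs0 : 0 < s := dist_pos.2 hxw
  set m := midpoint ℝ x w with hm
  have hxm : dist m x = s / 2 := by
    rw [hm, dist_midpoint_left]; norm_num; ring
  have hwm : dist m w = s / 2 := by
    rw [hm, dist_midpoint_right]; norm_num; ring
  have hsub : Set.Ioo s (2 * s) ×ˢ ball m (s / 2) ⊆ scaleCenters z (4 * R) (x, w) := by
    rintro ⟨r, u⟩ ⟨⟨h1, h2⟩, h3⟩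
    simp only [mem_ball] at h1 h2 h3 hx
    have h4 := dist_triangle u m x
    have h5 := dist_triangle u m w
    have h6 := dist_triangle u x z
    refine ⟨⟨by simp only; linarith, by simp only; linarith⟩, ?_, ?_, ?_⟩ <;>
      simp only [mem_ball]
    · linarith
    · rw [dist_comm]; linarith
    · rw [dist_comm]; linarith
  have hvol : volume (ball m (s / 2)) = ENNReal.ofReal (v * (s / 2) ^ d) := by
    rw [hv, ← volumeReal_ball m (by positivity), ofReal_measureReal measure_ball_lt_top.ne]
  calc ENNReal.ofReal (2 ^ (-2 * α - 1) / (4 * v * 8 ^ d) / s ^ (d + 2 * α))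
      = ENNReal.ofReal (sqWeight d α v (2 * s)) *
          (volume : Measure (ℝ × EuclideanSpace ℝ (Fin d)))
            (Set.Ioo s (2 * s) ×ˢ ball m (s / 2)) := by
        rw [Measure.volume_eq_prod, Measure.prod_prod, hvol, Real.volume_Ioo,
          ← ENNReal.ofReal_mul (by linarith), ← ENNReal.ofReal_mul (by unfold sqWeight; positivity)]
        congr 1
        have e1 : s ^ (d + 2 * α) = s ^ d * s ^ (2 * α) := by
          rw [Real.rpow_add hs0, Real.rpow_natCast]
        have e2 : s ^ (-2 * α - 1) = (s ^ (2 * α))⁻¹ / s := by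
          rw [Real.rpow_sub_one hs0.ne', ← Real.rpow_neg hs0.le, neg_mul]
        have e3 : (8 : ℝ) ^ d = 2 ^ d * 2 ^ d * 2 ^ d := by
          rw [← mul_pow, ← mul_pow]; norm_num
        rw [sqWeight, Real.mul_rpow (by norm_num) hs0.le, e1, e2, e3, mul_pow, div_pow]
        have := (Real.rpow_pos_of_pos hs0 (2 * α)).ne'
        field_simp
        ring
    _ = ∫⁻ p in Set.Ioo s (2 * s) ×ˢ ball m (s / 2),
          ENNReal.ofReal (sqWeight d α v (2 * s)) := by
        rw [setLIntegral_const]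
    _ ≤ ∫⁻ p in Set.Ioo s (2 * s) ×ˢ ball m (s / 2), ENNReal.ofReal (sqWeight d α v p.1) :=
        setLIntegral_mono' (measurableSet_Ioo.prod measurableSet_ball) fun p hp =>
          ENNReal.ofReal_le_ofReal (sqWeight_anti hα hv0 (hs0.trans hp.1.1) hp.1.2.le)
    _ ≤ _ := lintegral_mono_set hsub

theorem lintegral_scaleCenters_le {d : ℕ} {α : ℝ} {f : EuclideanSpace ℝ (Fin d) → ℝ}
    (hf : Measurable f) (hf2 : LocallyIntegrable (fun x => (f x) ^ 2) volume)
    (z : EuclideanSpace ℝ (Fin d)) (ρ : ℝ)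
    {v : ℝ} (hv : v = volume.real (ball (0 : EuclideanSpace ℝ (Fin d)) 1)) :
    ∫⁻ q : EuclideanSpace ℝ (Fin d) × EuclideanSpace ℝ (Fin d),
      (∫⁻ p in scaleCenters z ρ q, ENNReal.ofReal (sqWeight d α v p.1)) *
        ENNReal.ofReal (|f q.1 - f q.2| ^ 2) ≤
    ∫⁻ r in Set.Ioo 0 ρ, (∫⁻ x in ball z ρ,
      ENNReal.ofReal ((nu0 d f x r / r ^ (α - 1)) ^ 2)) / ENNReal.ofReal r := by
  set φ : ℝ × EuclideanSpace ℝ (Fin d) →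
      EuclideanSpace ℝ (Fin d) × EuclideanSpace ℝ (Fin d) → ENNReal := fun p q =>
    (scaleCenters z ρ q).indicator (fun p => ENNReal.ofReal (sqWeight d α v p.1)) p *
      ENNReal.ofReal (|f q.1 - f q.2| ^ 2) with hφ
  have hφm : Measurable (Function.uncurry φ) :=
    (measurable_indicator_scaleCenters α v z ρ).mul (by fun_prop)
  calc _ = ∫⁻ q, ∫⁻ p, φ p q := by
        refine lintegral_congr fun q => ?_
        rw [hφ, lintegral_mul_const' _ _ ENNReal.ofReal_ne_top,
          lintegral_indicator (measurableSet_scaleCenters_apply z ρ q)]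
    _ = ∫⁻ p, ∫⁻ q, φ p q := (lintegral_lintegral_swap hφm.aemeasurable).symm
    _ ≤ ∫⁻ r, ∫⁻ u, ∫⁻ q, φ (r, u) q := lintegral_prod_le _
    _ ≤ _ := ?_
  rw [← lintegral_indicator measurableSet_Ioo]
  refine lintegral_mono fun r => ?_
  by_cases hr : r ∈ Set.Ioo 0 ρ
  swap
  · have h0 (u) (q) : φ (r, u) q = 0 := by
      rw [hφ]
      simp only
      rw [Set.indicator_of_notMem (fun h => hr h.1), zero_mul]
    simp [h0]
  rw [Set.indicator_of_mem hr, div_eq_mul_inv,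
    ← lintegral_mul_const' _ _ (by simpa using hr.1), ← lintegral_indicator measurableSet_ball]
  refine lintegral_mono fun u => ?_
  by_cases hu : u ∈ ball z ρ
  swap
  · have h0 (q) : φ (r, u) q = 0 := by
      rw [hφ]
      simp only
      rw [Set.indicator_of_notMem (fun h => hu h.2.1), zero_mul]
    simp [h0]
  rw [Set.indicator_of_mem hu]
  refine le_trans (le_of_eq ?_) (sqWeight_mul_lintegral_le hf hf2 u hr.1)
  rw [← hv, ← lintegral_const_mul' _ _ ENNReal.ofReal_ne_top,
    ← lintegral_indicator (measurableSet_ball.prod measurableSet_ball)]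
  refine lintegral_congr fun q => ?_
  rw [hφ]
  simp only
  by_cases hq : q ∈ ball u r ×ˢ ball u r
  · rw [Set.indicator_of_mem hq, Set.indicator_of_mem (show (r, u) ∈ scaleCenters z ρ q from
      ⟨hr, hu, hq⟩)]
  · rw [Set.indicator_of_notMem hq, Set.indicator_of_notMem (fun h => hq h.2.2), zero_mul]

/-- For `0 < α < 1`, the square function bound
`∫_0^R ∫_{B_R(z)} (ν₀^f(x,r)/r^{α−1})² dx dr/r ≤ C₁ R^d` implies the Strichartz bound
`∫_{B_R(z)} ∫_{|y|≤R} |f(x)−f(x+y)|²/|y|^{d+2α} dy dx ≤ C C₁ R^d` with `C = C(d,α)`. -/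
theorem nu0_square_function_implies_strichartz (d : ℕ) (hd : 0 < d)
    (α : ℝ) (hα0 : 0 < α) (hα1 : α < 1) :
    ∃ C : ℝ, 0 < C ∧
      ∀ (f : EuclideanSpace ℝ (Fin d) → ℝ) (C₁ : ℝ), Measurable f →
        LocallyIntegrable (fun x => (f x) ^ 2) volume → 0 ≤ C₁ →
        (∀ (z : EuclideanSpace ℝ (Fin d)) (R : ℝ), 0 < R →
          (∫⁻ r in Set.Ioo (0 : ℝ) R,
            (∫⁻ x in ball z R,
              ENNReal.ofReal ((nu0 d f x r / r ^ (α - 1)) ^ 2)) / ENNReal.ofReal r)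
            ≤ ENNReal.ofReal (C₁ * R ^ (d : ℕ))) →
        ∀ (z : EuclideanSpace ℝ (Fin d)) (R : ℝ), 0 < R →
          (∫⁻ x in ball z R, ∫⁻ y in closedBall (0 : EuclideanSpace ℝ (Fin d)) R,
            ENNReal.ofReal (|f x - f (x + y)| ^ 2 / ‖y‖ ^ ((d : ℝ) + 2 * α)))
            ≤ ENNReal.ofReal (C * C₁ * R ^ (d : ℕ)) := by
  set v := volume.real (ball (0 : EuclideanSpace ℝ (Fin d)) 1) with hv
  have hv0 : 0 < v :=
    ENNReal.toReal_pos (measure_ball_pos _ _ one_pos).ne' measure_ball_lt_top.ne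
  set c : ℝ := 2 ^ (-2 * α - 1) / (4 * v * 8 ^ d) with hc
  have hc0 : 0 < c := by positivity
  refine ⟨4 ^ d / c, by positivity, fun f C₁ hf hf2 hC₁ H z R hR => ?_⟩
  have hH := (lintegral_scaleCenters_le hf hf2 z (4 * R) hv).trans (H z (4 * R) (by positivity))
  set ψ : EuclideanSpace ℝ (Fin d) × EuclideanSpace ℝ (Fin d) → ENNReal := fun q =>
    (∫⁻ p in scaleCenters z (4 * R) q, ENNReal.ofReal (sqWeight d α v p.1)) *
      ENNReal.ofReal (|f q.1 - f q.2| ^ 2) with hψ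
  have hpt (x y : EuclideanSpace ℝ (Fin d)) (hx : x ∈ ball z R)
      (hy : y ∈ closedBall (0 : EuclideanSpace ℝ (Fin d)) R) :
      ENNReal.ofReal (|f x - f (x + y)| ^ 2 / ‖y‖ ^ ((d : ℝ) + 2 * α)) ≤
        ENNReal.ofReal c⁻¹ * ψ (x, x + y) := by
    rcases eq_or_ne y 0 with rfl | hy0
    · simp
    have hd : dist x (x + y) = ‖y‖ := by simp
    have h := div_rpow_le_lintegral_scaleCenters hα0 hx (w := x + y) (by simpa using hy0)
      (by rw [hd]; simpa using hy) hv
    rw [hd, ← hc] at h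
    calc _ = ENNReal.ofReal c⁻¹ * (ENNReal.ofReal (c / ‖y‖ ^ ((d : ℝ) + 2 * α)) *
          ENNReal.ofReal (|f x - f (x + y)| ^ 2)) := by
          rw [← ENNReal.ofReal_mul (by positivity), ← ENNReal.ofReal_mul (by positivity)]
          congr 1
          field_simp
      _ ≤ _ := by simp only [hψ]; gcongr
  have hψm : Measurable ψ := (measurable_lintegral_scaleCenters α v z (4 * R)).mul (by fun_prop)
  calc _ ≤ ∫⁻ x in ball z R, ∫⁻ y in closedBall (0 : EuclideanSpace ℝ (Fin d)) R,
        ENNReal.ofReal c⁻¹ * ψ (x, x + y) :=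
        setLIntegral_mono' measurableSet_ball fun x hx =>
          setLIntegral_mono' measurableSet_closedBall fun y hy => hpt x y hx hy
    _ ≤ ∫⁻ x, ∫⁻ y, ENNReal.ofReal c⁻¹ * ψ (x, x + y) :=
        (setLIntegral_le_lintegral _ _).trans
          (lintegral_mono fun x => setLIntegral_le_lintegral _ _)
    _ = ENNReal.ofReal c⁻¹ * ∫⁻ q, ψ q := by
        rw [Measure.volume_eq_prod, lintegral_prod _ hψm.aemeasurable,
          ← lintegral_const_mul' _ _ ENNReal.ofReal_ne_top]
        refine lintegral_congr fun x => ?_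
        rw [lintegral_const_mul' _ _ ENNReal.ofReal_ne_top,
          lintegral_add_left_eq_self (fun w => ψ (x, w)) x]
    _ ≤ ENNReal.ofReal c⁻¹ * ENNReal.ofReal (C₁ * (4 * R) ^ d) := by gcongr
    _ = _ := by
        rw [← ENNReal.ofReal_mul (by positivity)]
        congr 1
        rw [mul_pow]
        ring
end

section
/- Let d ≥ 1, 1 ≤ α < 2, and let f : ℝ^d → ℝ be locally square-integrable. Suppose there is C₁ < ∞ such that for every z ∈ ℝ^d and R > 0, ∫_0^R ∫_{B_R(z)} ( ν₁^f(x,r) / r^{α−1} )² dx dr/r ≤ C₁ R^d. Then there is a constant C depending only on d and α such that for every z ∈ ℝ^d and R > 0, ∫_{B_R(z)} ∫_{|y| ≤ R} |2f(x) − f(x+y) − f(x−y)|² / |y|^{d+2α} dy dx ≤ C C₁ R^d. (By Strichartz's characterization, this conclusion together with the tempered growth condition ∫ |f(x)|/(1+|x|^{d+ε}) dx < ∞ for all ε > α means f ∈ I_α(BMO) with ‖D_α f‖_*² ≲ C₁.) -/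
open MeasureTheory Metric RealInnerProductSpace

/-- The squared symmetric second difference of `f`. -/
noncomputable def sqSecondDiff {d : ℕ} (f : EuclideanSpace ℝ (Fin d) → ℝ)
    (x y : EuclideanSpace ℝ (Fin d)) : ENNReal :=
  ENNReal.ofReal (|2 * f x - f (x + y) - f (x - y)| ^ 2)

theorem measurable_sqSecondDiff {d : ℕ} {f : EuclideanSpace ℝ (Fin d) → ℝ} (hf : Measurable f) :
    Measurable (fun q : EuclideanSpace ℝ (Fin d) × EuclideanSpace ℝ (Fin d) =>
      sqSecondDiff f q.1 q.2) := by
  unfold sqSecondDiff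
  simp only [sq_abs]
  have h1 : Measurable fun q : EuclideanSpace ℝ (Fin d) × EuclideanSpace ℝ (Fin d) => f q.1 :=
    hf.comp measurable_fst
  have h2 : Measurable fun q : EuclideanSpace ℝ (Fin d) × EuclideanSpace ℝ (Fin d) =>
      f (q.1 + q.2) := hf.comp (measurable_fst.add measurable_snd)
  have h3 : Measurable fun q : EuclideanSpace ℝ (Fin d) × EuclideanSpace ℝ (Fin d) =>
      f (q.1 - q.2) := hf.comp (measurable_fst.sub measurable_snd)
  exact ((((h1.const_mul 2).sub h2).sub h3).pow_const 2).ennreal_ofReal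

theorem measurableSet_mem_ball_half {E : Type*} [NormedAddCommGroup E] [MeasurableSpace E]
    [BorelSpace E] [SecondCountableTopology E] :
    MeasurableSet {q : E × ℝ | q.1 ∈ ball (0 : E) (q.2 / 2)} := by
  simp only [mem_ball_zero_iff]
  exact measurableSet_lt measurable_fst.norm (measurable_snd.div_const 2)

/-- Averaging a nonnegative function over small balls does not lose mass. -/
theorem setLIntegral_ball_mul_volume_le {d : ℕ} {g : EuclideanSpace ℝ (Fin d) → ENNReal}
    (hg : Measurable g) (z : EuclideanSpace ℝ (Fin d)) (R ρ : ℝ) :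
    (∫⁻ x in ball z R, g x) * volume (ball (0 : EuclideanSpace ℝ (Fin d)) ρ) ≤
      ∫⁻ w in ball z (R + ρ), ∫⁻ x in ball w ρ, g x := by
  have hm : Measurable (fun q : EuclideanSpace ℝ (Fin d) × EuclideanSpace ℝ (Fin d) =>
      (ball q.2 ρ).indicator g q.1) := by
    have hS : MeasurableSet {q : EuclideanSpace ℝ (Fin d) × EuclideanSpace ℝ (Fin d) |
        dist q.1 q.2 < ρ} :=
      measurableSet_lt (measurable_fst.dist measurable_snd) measurable_const
    have hg1 : Measurable fun q : EuclideanSpace ℝ (Fin d) × EuclideanSpace ℝ (Fin d) => g q.1 :=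
      hg.comp measurable_fst
    convert hg1.indicator hS using 1
    ext q
    classical simp only [Set.indicator_apply, mem_ball, Set.mem_ofPred_eq]
  calc (∫⁻ x in ball z R, g x) * volume (ball (0 : EuclideanSpace ℝ (Fin d)) ρ)
      = ∫⁻ x in ball z R, g x * volume (ball (0 : EuclideanSpace ℝ (Fin d)) ρ) :=
        (lintegral_mul_const _ hg).symm
    _ ≤ ∫⁻ x in ball z R, ∫⁻ w in ball z (R + ρ), (ball w ρ).indicator g x := by
        refine setLIntegral_mono' measurableSet_ball fun x hx => ?_
        have hsub : ball x ρ ⊆ ball z (R + ρ) := ball_subset_ball' (by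
          have := mem_ball.1 hx
          linarith)
        have : ∀ w, (ball w ρ).indicator g x = (ball x ρ).indicator (fun _ => g x) w := by
          intro w
          classical simp only [Set.indicator_apply, mem_ball, dist_comm]
        rw [lintegral_congr this]
        rw [lintegral_indicator_const measurableSet_ball, Measure.restrict_apply measurableSet_ball,
          Set.inter_eq_left.2 hsub, Measure.addHaar_ball_center volume x ρ]
    _ ≤ ∫⁻ x, ∫⁻ w in ball z (R + ρ), (ball w ρ).indicator g x := setLIntegral_le_lintegral _ _
    _ = ∫⁻ w in ball z (R + ρ), ∫⁻ x, (ball w ρ).indicator g x := 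
        lintegral_lintegral_swap hm.aemeasurable
    _ = _ := by
        exact lintegral_congr fun w => lintegral_indicator measurableSet_ball g

theorem rpow_neg_le_setLIntegral {a β : ℝ} (ha : 0 < a) (hβ : 0 ≤ β) :
    ENNReal.ofReal (1 / a ^ β) ≤
      ∫⁻ s in Set.Ioo (2 * a) (4 * a), ENNReal.ofReal (2 * 4 ^ β / s ^ (β + 1)) := by
  calc ENNReal.ofReal (1 / a ^ β)
      = ∫⁻ s in Set.Ioo (2 * a) (4 * a), ENNReal.ofReal (2 * 4 ^ β / (4 * a) ^ (β + 1)) := by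
        rw [setLIntegral_const, Real.volume_Ioo, ← ENNReal.ofReal_mul (by positivity)]
        congr 1
        rw [Real.rpow_add_one (by positivity), Real.mul_rpow (by norm_num) ha.le]
        field_simp
        ring
    _ ≤ _ := by
        refine setLIntegral_mono' measurableSet_Ioo fun s hs => ENNReal.ofReal_le_ofReal ?_
        have h0 : 0 < s := by linarith [hs.1]
        gcongr
        exact hs.2.le

/-- Tonelli's theorem for a superposition over scales `s` of truncated integrals. -/
theorem lintegral_superposition_scales {E : Type*} [NormedAddCommGroup E] [MeasurableSpace E]
    [BorelSpace E] [SecondCountableTopology E] (μ ν : Measure E) [SFinite μ] [SFinite ν]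
    (κ : Measure ℝ) [SFinite κ] {D : E → E → ENNReal} (hD : Measurable (Function.uncurry D))
    {k : ℝ → ENNReal} (hk : Measurable k) :
    ∫⁻ x, ∫⁻ y, ∫⁻ s, k s * (ball (0 : E) (s / 2)).indicator (D x) y ∂κ ∂ν ∂μ =
      ∫⁻ s, k s * ∫⁻ x, ∫⁻ y in ball (0 : E) (s / 2), D x y ∂ν ∂μ ∂κ := by
  have hDm : Measurable fun q : (E × ℝ) × E =>
      (ball (0 : E) (q.1.2 / 2)).indicator (D q.1.1) q.2 := by
    have h1 : Measurable fun q : (E × ℝ) × E => D q.1.1 q.2 :=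
      hD.comp ((measurable_fst.comp measurable_fst).prodMk measurable_snd)
    have h2 : Measurable fun q : (E × ℝ) × E => (q.2, q.1.2) := by fun_prop
    convert h1.indicator (h2 measurableSet_mem_ball_half) using 1
    ext q
    classical simp only [Set.indicator_apply, Set.mem_preimage, Set.mem_ofPred_eq]
  have hFm : Measurable fun q : (E × ℝ) × E =>
      k q.1.2 * (ball (0 : E) (q.1.2 / 2)).indicator (D q.1.1) q.2 :=
    (hk.comp (measurable_snd.comp measurable_fst)).mul hDm
  have hI : ∀ (x : E) (s : ℝ), ∫⁻ y, k s * (ball (0 : E) (s / 2)).indicator (D x) y ∂ν =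
      k s * ∫⁻ y in ball (0 : E) (s / 2), D x y ∂ν := by
    intro x s
    have hDx : Measurable (D x) := hD.comp measurable_prodMk_left
    rw [lintegral_const_mul _ (hDx.indicator measurableSet_ball),
      lintegral_indicator measurableSet_ball]
  calc _ = ∫⁻ x, ∫⁻ s, ∫⁻ y, k s * (ball (0 : E) (s / 2)).indicator (D x) y ∂ν ∂κ ∂μ := by
        refine lintegral_congr fun x => lintegral_lintegral_swap (Measurable.aemeasurable ?_)
        exact hFm.comp ((measurable_const.prodMk measurable_snd).prodMk measurable_fst)
    _ = ∫⁻ s, ∫⁻ x, ∫⁻ y, k s * (ball (0 : E) (s / 2)).indicator (D x) y ∂ν ∂μ ∂κ :=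
        lintegral_lintegral_swap (hFm.lintegral_prod_right').aemeasurable
    _ = _ := by
        refine lintegral_congr fun s => ?_
        rw [lintegral_congr fun x => hI x s, lintegral_const_mul]
        have hDi : Measurable fun q : E × E => D q.1 q.2 := hD
        exact hDi.lintegral_prod_right'

/-- Writing `‖y‖⁻ᵝ` as an average over scales `s ∼ ‖y‖`. -/
theorem secondDiff_lintegral_le_scales {d : ℕ} {f : EuclideanSpace ℝ (Fin d) → ℝ}
    (hf : Measurable f) {β : ℝ} (hβ : 0 < β) (z : EuclideanSpace ℝ (Fin d)) {R : ℝ} :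
    (∫⁻ x in ball z R, ∫⁻ y in closedBall (0 : EuclideanSpace ℝ (Fin d)) R,
      ENNReal.ofReal (|2 * f x - f (x + y) - f (x - y)| ^ 2 / ‖y‖ ^ β)) ≤
    ∫⁻ s in Set.Ioo (0 : ℝ) (4 * R), ENNReal.ofReal (2 * 4 ^ β / s ^ (β + 1)) *
      ∫⁻ x in ball z R, ∫⁻ y in ball (0 : EuclideanSpace ℝ (Fin d)) (s / 2),
        sqSecondDiff f x y := by
  have hkm : Measurable fun s : ℝ => ENNReal.ofReal (2 * 4 ^ β / s ^ (β + 1)) := by fun_prop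
  rw [← lintegral_superposition_scales _ _ _ (measurable_sqSecondDiff hf) hkm]
  refine lintegral_mono fun x => (setLIntegral_mono' measurableSet_closedBall fun y hy => ?_).trans
    (setLIntegral_le_lintegral _ _)
  rcases eq_or_ne y 0 with rfl | hy0
  · simp [Real.zero_rpow hβ.ne']
  have hpos : 0 < ‖y‖ := norm_pos_iff.2 hy0
  have hyR : ‖y‖ ≤ R := by simpa using hy
  calc _ = ENNReal.ofReal (1 / ‖y‖ ^ β) * sqSecondDiff f x y := by
        rw [div_eq_mul_one_div, ENNReal.ofReal_mul (by positivity), mul_comm, sqSecondDiff]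
    _ ≤ (∫⁻ s in Set.Ioo (2 * ‖y‖) (4 * ‖y‖), ENNReal.ofReal (2 * 4 ^ β / s ^ (β + 1))) *
        sqSecondDiff f x y := by
        gcongr
        exact rpow_neg_le_setLIntegral hpos hβ.le
    _ = ∫⁻ s in Set.Ioo (2 * ‖y‖) (4 * ‖y‖), ENNReal.ofReal (2 * 4 ^ β / s ^ (β + 1)) *
        sqSecondDiff f x y := (lintegral_mul_const _ hkm).symm
    _ = ∫⁻ s in Set.Ioo (2 * ‖y‖) (4 * ‖y‖), ENNReal.ofReal (2 * 4 ^ β / s ^ (β + 1)) *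
        (ball (0 : EuclideanSpace ℝ (Fin d)) (s / 2)).indicator (sqSecondDiff f x) y := by
        refine setLIntegral_congr_fun measurableSet_Ioo fun s hs => ?_
        have : y ∈ ball (0 : EuclideanSpace ℝ (Fin d)) (s / 2) := by
          rw [mem_ball_zero_iff]
          linarith [hs.1]
        simp only [Set.indicator_of_mem this]
    _ ≤ _ := lintegral_mono_set (Set.Ioo_subset_Ioo (by positivity) (by linarith))

/-- On a ball, the second differences of `f` are controlled by the distance of `f` to any
affine function in `L²`. -/
theorem lintegral_sqSecondDiff_le {d : ℕ} {f : EuclideanSpace ℝ (Fin d) → ℝ}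
    (hf : Measurable f) (w : EuclideanSpace ℝ (Fin d)) {s : ℝ} (hs : 0 < s)
    (p : EuclideanSpace ℝ (Fin d) × ℝ) :
    (∫⁻ x in ball w (s / 2), ∫⁻ y in ball (0 : EuclideanSpace ℝ (Fin d)) (s / 2),
      sqSecondDiff f x y) ≤
    18 * volume (ball (0 : EuclideanSpace ℝ (Fin d)) s) *
      ∫⁻ u in ball w s, ENNReal.ofReal ((f u - (⟪p.1, u⟫ + p.2)) ^ 2) := by
  set e : EuclideanSpace ℝ (Fin d) → ENNReal :=
    fun u => ENNReal.ofReal ((f u - (⟪p.1, u⟫ + p.2)) ^ 2) with he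
  have hem : Measurable e := by
    rw [he]
    fun_prop
  set V := volume (ball (0 : EuclideanSpace ℝ (Fin d)) s)
  have hVs : volume (ball (0 : EuclideanSpace ℝ (Fin d)) (s / 2)) ≤ V :=
    measure_mono (ball_subset_ball (by linarith))
  have hD : ∀ x y, sqSecondDiff f x y ≤ 12 * e x + 3 * e (x + y) + 3 * e (x - y) := by
    intro x y
    simp only [sqSecondDiff, he]
    rw [show (12 : ENNReal) = ENNReal.ofReal 12 by simp,
      show (3 : ENNReal) = ENNReal.ofReal 3 by simp,
      ← ENNReal.ofReal_mul (by norm_num), ← ENNReal.ofReal_mul (by norm_num),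
      ← ENNReal.ofReal_mul (by norm_num), ← ENNReal.ofReal_add (by positivity) (by positivity),
      ← ENNReal.ofReal_add (by positivity) (by positivity)]
    refine ENNReal.ofReal_le_ofReal ?_
    rw [sq_abs, inner_add_right, inner_sub_right]
    generalize inner ℝ p.1 x = a
    generalize inner ℝ p.1 y = b
    have key : ∀ A B C : ℝ, (2 * A - B - C) ^ 2 ≤ 12 * A ^ 2 + 3 * B ^ 2 + 3 * C ^ 2 := by
      intro A B C
      nlinarith [sq_nonneg (2 * A + B), sq_nonneg (2 * A + C), sq_nonneg (B - C)]
    convert key (f x - (a + p.2)) (f (x + y) - (a + b + p.2)) (f (x - y) - (a - b + p.2)) using 1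
    ring
  have hadd : ∀ x ∈ ball w (s / 2),
      ∫⁻ y in ball (0 : EuclideanSpace ℝ (Fin d)) (s / 2), e (x + y) ≤ ∫⁻ u in ball w s, e u := by
    intro x hx
    rw [← lintegral_indicator measurableSet_ball, ← lintegral_indicator measurableSet_ball,
      ← lintegral_add_left_eq_self ((ball w s).indicator e) x]
    refine lintegral_mono fun y => ?_
    by_cases hy : y ∈ ball (0 : EuclideanSpace ℝ (Fin d)) (s / 2)
    · have : x + y ∈ ball w s := by
        rw [mem_ball_zero_iff] at hy
        rw [mem_ball_iff_norm] at hx ⊢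
        calc ‖x + y - w‖ = ‖(x - w) + y‖ := by congr 1; abel
          _ ≤ ‖x - w‖ + ‖y‖ := norm_add_le _ _
          _ < s := by linarith
      rw [Set.indicator_of_mem hy, Set.indicator_of_mem this]
    · simp [Set.indicator_of_notMem hy]
  have hsub : ∀ x ∈ ball w (s / 2),
      ∫⁻ y in ball (0 : EuclideanSpace ℝ (Fin d)) (s / 2), e (x - y) ≤ ∫⁻ u in ball w s, e u := by
    intro x hx
    refine le_trans (le_of_eq ?_) (hadd x hx)
    rw [← lintegral_indicator measurableSet_ball, ← lintegral_indicator measurableSet_ball,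
      ← lintegral_neg_eq_self ((ball 0 (s / 2)).indicator fun y => e (x + y))]
    refine lintegral_congr fun y => ?_
    classical simp only [Set.indicator_apply, mem_ball_zero_iff, norm_neg, sub_eq_add_neg]
  set I := ∫⁻ u in ball w s, e u
  calc _ ≤ ∫⁻ x in ball w (s / 2), (12 * V * e x + 6 * I) := by
        refine setLIntegral_mono' measurableSet_ball fun x hx => ?_
        calc _ ≤ ∫⁻ y in ball (0 : EuclideanSpace ℝ (Fin d)) (s / 2),
              (12 * e x + 3 * e (x + y) + 3 * e (x - y)) := lintegral_mono fun y => hD x y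
          _ = 12 * e x * volume (ball (0 : EuclideanSpace ℝ (Fin d)) (s / 2)) +
              3 * (∫⁻ y in ball (0 : EuclideanSpace ℝ (Fin d)) (s / 2), e (x + y)) +
              3 * (∫⁻ y in ball (0 : EuclideanSpace ℝ (Fin d)) (s / 2), e (x - y)) := by
              rw [lintegral_add_left (by fun_prop), lintegral_add_left (by fun_prop),
                setLIntegral_const, lintegral_const_mul' _ _ (by simp),
                lintegral_const_mul' _ _ (by simp)]
          _ ≤ 12 * e x * V + 3 * I + 3 * I := by
              gcongr
              · exact hadd x hx
              · exact hsub x hx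
          _ = _ := by ring
    _ = 12 * V * (∫⁻ x in ball w (s / 2), e x) +
        6 * I * volume (ball (0 : EuclideanSpace ℝ (Fin d)) (s / 2)) := by
        rw [lintegral_add_left (by fun_prop), lintegral_const_mul _ hem, setLIntegral_const,
          Measure.addHaar_ball_center]
    _ ≤ 12 * V * I + 6 * I * V := by
        gcongr
        exact lintegral_mono_set (ball_subset_ball (by linarith))
    _ = 18 * V * I := by ring

theorem lintegral_sqSecondDiff_le_nu1 {d : ℕ} {f : EuclideanSpace ℝ (Fin d) → ℝ}
    (hf : Measurable f) (hf2 : LocallyIntegrable (fun x => (f x) ^ 2) volume)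
    (w : EuclideanSpace ℝ (Fin d)) {s : ℝ} (hs : 0 < s) :
    (∫⁻ x in ball w (s / 2), ∫⁻ y in ball (0 : EuclideanSpace ℝ (Fin d)) (s / 2),
      sqSecondDiff f x y) ≤
    ENNReal.ofReal (18 * volume.real (ball (0 : EuclideanSpace ℝ (Fin d)) s) ^ 2 * s ^ 2 *
      nu1 d f w s ^ 2) := by
  set V := volume.real (ball (0 : EuclideanSpace ℝ (Fin d)) s) with hV
  have hVpos : 0 < V := ENNReal.toReal_pos (measure_ball_pos _ _ hs).ne' measure_ball_lt_top.ne
  have hVw : volume.real (ball w s) = V := by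
    simp only [hV, Measure.real, Measure.addHaar_ball_center]
  set G := ∫⁻ x in ball w (s / 2), ∫⁻ y in ball (0 : EuclideanSpace ℝ (Fin d)) (s / 2),
    sqSecondDiff f x y
  have hbound : ∀ p : EuclideanSpace ℝ (Fin d) × ℝ, G ≤ ENNReal.ofReal (18 * V ^ 2 * s ^ 2 *
      ⨍ y in ball w s, ((f y - (⟪p.1, y⟫ + p.2)) / s) ^ 2) := by
    intro p
    refine (lintegral_sqSecondDiff_le hf w hs p).trans (le_of_eq ?_)
    have hLp : MemLp f 2 (volume.restrict (ball w s)) := by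
      rw [memLp_two_iff_integrable_sq hf.aestronglyMeasurable]
      exact (hf2.integrableOn_isCompact (isCompact_closedBall w s)).mono_set ball_subset_closedBall
    have hLp' : MemLp (fun y => ⟪p.1, y⟫ + p.2) 2 (volume.restrict (ball w s)) := by
      rw [memLp_two_iff_integrable_sq (by fun_prop)]
      have hc : Continuous fun y : EuclideanSpace ℝ (Fin d) => (⟪p.1, y⟫ + p.2) ^ 2 := by fun_prop
      exact (hc.continuousOn.integrableOn_compact (isCompact_closedBall w s)).mono_set
        ball_subset_closedBall
    have hint : Integrable (fun u => (f u - (⟪p.1, u⟫ + p.2)) ^ 2)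
        (volume.restrict (ball w s)) := (hLp.sub hLp').integrable_sq
    rw [← ofReal_integral_eq_lintegral_ofReal hint (by filter_upwards with u using sq_nonneg _),
      setAverage_eq, hVw,
      ← ENNReal.ofReal_toReal (measure_ball_lt_top (μ := volume)
        (x := (0 : EuclideanSpace ℝ (Fin d))) (r := s)).ne,
      show (18 : ENNReal) = ENNReal.ofReal 18 by simp, ← ENNReal.ofReal_mul (by norm_num),
      ← ENNReal.ofReal_mul (by positivity)]
    simp_rw [div_pow]
    rw [integral_div, smul_eq_mul]
    congr 1
    change 18 * V * _ = _
    field_simp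
  have hGtop : G ≠ ⊤ := ne_top_of_le_ne_top ENNReal.ofReal_ne_top (hbound 0)
  rw [ENNReal.le_ofReal_iff_toReal_le hGtop (by positivity)]
  set K := 18 * V ^ 2 * s ^ 2
  have hK : 0 < K := by positivity
  have hle : Real.sqrt (G.toReal / K) ≤ nu1 d f w s := by
    refine le_ciInf fun p => Real.sqrt_le_sqrt ?_
    rw [div_le_iff₀' hK]
    refine ENNReal.toReal_le_of_le_ofReal ?_ (hbound p)
    have : 0 ≤ ⨍ y in ball w s, ((f y - (⟪p.1, y⟫ + p.2)) / s) ^ 2 := by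
      rw [setAverage_eq, smul_eq_mul]
      exact mul_nonneg (by positivity) (integral_nonneg fun _ => sq_nonneg _)
    positivity
  rw [← div_le_iff₀' hK]
  calc G.toReal / K = Real.sqrt (G.toReal / K) ^ 2 := (Real.sq_sqrt (by positivity)).symm
    _ ≤ _ := by gcongr

theorem setLIntegral_sqSecondDiff_le_nu1 {d : ℕ} {f : EuclideanSpace ℝ (Fin d) → ℝ}
    (hf : Measurable f) (hf2 : LocallyIntegrable (fun x => (f x) ^ 2) volume)
    (z : EuclideanSpace ℝ (Fin d)) {R s : ℝ} (hs : 0 < s) (hsR : s < 4 * R) :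
    (∫⁻ x in ball z R, ∫⁻ y in ball (0 : EuclideanSpace ℝ (Fin d)) (s / 2),
      sqSecondDiff f x y) ≤
    ∫⁻ w in ball z (4 * R), ENNReal.ofReal (18 * 2 ^ d *
      volume.real (ball (0 : EuclideanSpace ℝ (Fin d)) 1) * s ^ (d + 2) * nu1 d f w s ^ 2) := by
  set V := volume.real (ball (0 : EuclideanSpace ℝ (Fin d)) 1) with hV
  have hVpos : 0 < V := ENNReal.toReal_pos (measure_ball_pos _ _ one_pos).ne' measure_ball_lt_top.ne
  have hvol : ∀ r : ℝ, 0 < r →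
      volume (ball (0 : EuclideanSpace ℝ (Fin d)) r) = ENNReal.ofReal (r ^ d * V) := by
    intro r hr
    rw [Measure.addHaar_ball_of_pos _ _ hr, ENNReal.ofReal_mul (by positivity), hV, Measure.real,
      ENNReal.ofReal_toReal measure_ball_lt_top.ne, finrank_euclideanSpace_fin]
  have hvolr : volume.real (ball (0 : EuclideanSpace ℝ (Fin d)) s) = s ^ d * V := by
    rw [Measure.real, hvol s hs, ENNReal.toReal_ofReal (by positivity)]
  have hg : Measurable fun x => ∫⁻ y in ball (0 : EuclideanSpace ℝ (Fin d)) (s / 2),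
      sqSecondDiff f x y := (measurable_sqSecondDiff hf).lintegral_prod_right'
  have h1 := setLIntegral_ball_mul_volume_le hg z R (s / 2)
  rw [hvol _ (by positivity)] at h1
  have hc : 0 < (s / 2) ^ d * V := by positivity
  rw [← ENNReal.mul_le_mul_iff_left (ENNReal.ofReal_pos.2 hc).ne' ENNReal.ofReal_ne_top]
  refine h1.trans ?_
  rw [← lintegral_mul_const' _ _ ENNReal.ofReal_ne_top]
  calc _ ≤ ∫⁻ w in ball z (4 * R), ∫⁻ x in ball w (s / 2),
        ∫⁻ y in ball (0 : EuclideanSpace ℝ (Fin d)) (s / 2), sqSecondDiff f x y :=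
        lintegral_mono_set (ball_subset_ball (by linarith))
    _ ≤ _ := by
        refine lintegral_mono fun w => (lintegral_sqSecondDiff_le_nu1 hf hf2 w hs).trans ?_
        rw [← ENNReal.ofReal_mul (by positivity), hvolr]
        refine ENNReal.ofReal_le_ofReal (le_of_eq ?_)
        rw [div_pow, pow_add]
        field_simp

/-- For `1 ≤ α < 2`, the square function bound
`∫_0^R ∫_{B_R(z)} (ν₁^f(x,r)/r^{α−1})² dx dr/r ≤ C₁ R^d` implies the Strichartz
second-difference bound
`∫_{B_R(z)} ∫_{|y|≤R} |2f(x)−f(x+y)−f(x−y)|²/|y|^{d+2α} dy dx ≤ C C₁ R^d` with `C = C(d,α)`. -/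
theorem nu1_square_function_implies_strichartz (d : ℕ) (hd : 0 < d)
    (α : ℝ) (hα0 : 1 ≤ α) (hα1 : α < 2) :
    ∃ C : ℝ, 0 < C ∧
      ∀ (f : EuclideanSpace ℝ (Fin d) → ℝ) (C₁ : ℝ), Measurable f →
        LocallyIntegrable (fun x => (f x) ^ 2) volume → 0 ≤ C₁ →
        (∀ (z : EuclideanSpace ℝ (Fin d)) (R : ℝ), 0 < R →
          (∫⁻ r in Set.Ioo (0 : ℝ) R,
            (∫⁻ x in ball z R,
              ENNReal.ofReal ((nu1 d f x r / r ^ (α - 1)) ^ 2)) / ENNReal.ofReal r)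
            ≤ ENNReal.ofReal (C₁ * R ^ (d : ℕ))) →
        ∀ (z : EuclideanSpace ℝ (Fin d)) (R : ℝ), 0 < R →
          (∫⁻ x in ball z R, ∫⁻ y in closedBall (0 : EuclideanSpace ℝ (Fin d)) R,
            ENNReal.ofReal
              (|2 * f x - f (x + y) - f (x - y)| ^ 2 / ‖y‖ ^ ((d : ℝ) + 2 * α)))
            ≤ ENNReal.ofReal (C * C₁ * R ^ (d : ℕ)) := by
  set V := volume.real (ball (0 : EuclideanSpace ℝ (Fin d)) 1) with hV
  have hVpos : 0 < V := ENNReal.toReal_pos (measure_ball_pos _ _ one_pos).ne' measure_ball_lt_top.ne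
  set β : ℝ := (d : ℝ) + 2 * α with hβ
  have hβpos : 0 < β := by positivity
  set K : ℝ := 2 * 4 ^ β * (18 * 2 ^ d * V) with hK
  have hKpos : 0 < K := by positivity
  refine ⟨K * 4 ^ d, by positivity, ?_⟩
  intro f C₁ hf hf2 hC₁ hsq z R hR
  calc _ ≤ ∫⁻ s in Set.Ioo (0 : ℝ) (4 * R), ENNReal.ofReal (2 * 4 ^ β / s ^ (β + 1)) *
      ∫⁻ x in ball z R, ∫⁻ y in ball (0 : EuclideanSpace ℝ (Fin d)) (s / 2),
        sqSecondDiff f x y := secondDiff_lintegral_le_scales hf hβpos z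
    _ ≤ ∫⁻ s in Set.Ioo (0 : ℝ) (4 * R), ENNReal.ofReal K *
        ((∫⁻ x in ball z (4 * R), ENNReal.ofReal ((nu1 d f x s / s ^ (α - 1)) ^ 2)) /
          ENNReal.ofReal s) := by
        refine setLIntegral_mono' measurableSet_Ioo fun s hs => ?_
        have hs0 : 0 < s := hs.1
        refine (mul_le_mul_right (setLIntegral_sqSecondDiff_le_nu1 hf hf2 z hs.1 hs.2) _).trans
          (le_of_eq ?_)
        rw [ENNReal.div_eq_inv_mul, ← ENNReal.ofReal_inv_of_pos hs0,
          ← mul_assoc, ← ENNReal.ofReal_mul hKpos.le,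
          ← lintegral_const_mul' _ _ ENNReal.ofReal_ne_top,
          ← lintegral_const_mul' _ _ ENNReal.ofReal_ne_top]
        refine lintegral_congr fun w => ?_
        rw [← ENNReal.ofReal_mul (by positivity), ← ENNReal.ofReal_mul (by positivity)]
        congr 1
        have hpow : s ^ (β + 1) = s ^ (d + 2) * (s ^ (α - 1)) ^ 2 * s := by
          have h2 : (s ^ (α - 1)) ^ 2 = s ^ (2 * α - 2) := by
            rw [← Real.rpow_natCast, ← Real.rpow_mul hs0.le]
            congr 1
            push_cast
            ring
          rw [h2, ← Real.rpow_natCast, ← Real.rpow_add hs0, ← Real.rpow_add_one hs0.ne']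
          congr 1
          push_cast
          ring
        rw [hpow, hK, ← hV]
        field_simp
    _ = ENNReal.ofReal K * ∫⁻ s in Set.Ioo (0 : ℝ) (4 * R),
        ((∫⁻ x in ball z (4 * R), ENNReal.ofReal ((nu1 d f x s / s ^ (α - 1)) ^ 2)) /
          ENNReal.ofReal s) := lintegral_const_mul' _ _ ENNReal.ofReal_ne_top
    _ ≤ ENNReal.ofReal K * ENNReal.ofReal (C₁ * (4 * R) ^ d) := by
        gcongr
        exact hsq z (4 * R) (by positivity)
    _ = _ := by
        rw [← ENNReal.ofReal_mul hKpos.le]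
        congr 1
        ring
end
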